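/- arXiv:math/9610213 — 7 statements merged into one kernel-verified Lean document; each statement's English description precedes it below -/
import Mathlib

section
/- For all finitely supported sequences a = (a_n) and b = (b_n) of real numbers, the coordinatewise product a ⋆ b = (a_n b_n) satisfies ‖a ⋆ b‖_J ≤ ‖a‖_J · ‖b‖_∞ + ‖a‖_∞ · ‖b‖_J, where ‖·‖_∞ denotes the supremum norm. -/
/-- The James norm of a sequence `x = (x₀, x₁, x₂, …)` of real numbers (the sequence is
indexed starting at `0`, corresponding to the paper's `x₁, x₂, …`):
`‖x‖_J = sup { √(x_{p 0}² + (x_{p 1} − x_{p 0})² + ⋯ + (x_{p k} − x_{p (k−1)})²) :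
  k ∈ ℕ, p : ℕ → ℕ strictly increasing }`. -/
noncomputable def jamesNorm (x : ℕ → ℝ) : ℝ :=
  sSup {r : ℝ | ∃ (k : ℕ) (p : ℕ → ℕ), StrictMono p ∧
    r = Real.sqrt ((x (p 0)) ^ 2 + ∑ i ∈ Finset.range k, (x (p (i + 1)) - x (p i)) ^ 2)}

/-- Minkowski's inequality for finite sums of squares. -/
theorem sqrt_sum_add_sq_le {ι : Type*} (s : Finset ι) (u v : ι → ℝ) :
    √(∑ i ∈ s, (u i + v i) ^ 2) ≤ √(∑ i ∈ s, u i ^ 2) + √(∑ i ∈ s, v i ^ 2) := by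
  refine Real.sqrt_le_iff.mpr ⟨by positivity, ?_⟩
  have hu : 0 ≤ ∑ i ∈ s, u i ^ 2 := Finset.sum_nonneg fun i _ => sq_nonneg _
  have hv : 0 ≤ ∑ i ∈ s, v i ^ 2 := Finset.sum_nonneg fun i _ => sq_nonneg _
  have hsum : ∑ i ∈ s, (u i + v i) ^ 2 =
      ∑ i ∈ s, u i ^ 2 + 2 * ∑ i ∈ s, u i * v i + ∑ i ∈ s, v i ^ 2 := by
    rw [Finset.mul_sum, ← Finset.sum_add_distrib, ← Finset.sum_add_distrib]
    exact Finset.sum_congr rfl fun i _ => by ring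
  rw [hsum, add_sq, Real.sq_sqrt hu, Real.sq_sqrt hv]
  linarith [Real.sum_mul_le_sqrt_mul_sqrt s u v]

/-- The square root of a finite sum of squares is monotone under a termwise bound
`|u i| ≤ c * |v i|`. -/
theorem sqrt_sum_sq_le_mul {ι : Type*} (s : Finset ι) (u v : ι → ℝ) {c : ℝ} (hc : 0 ≤ c)
    (h : ∀ i ∈ s, |u i| ≤ c * |v i|) :
    √(∑ i ∈ s, u i ^ 2) ≤ c * √(∑ i ∈ s, v i ^ 2) := by
  rw [← Real.sqrt_sq hc, ← Real.sqrt_mul (sq_nonneg c), Finset.mul_sum]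
  refine Real.sqrt_le_sqrt (Finset.sum_le_sum fun i hi => ?_)
  rw [← mul_pow, sq_le_sq, abs_mul, abs_of_nonneg hc]
  exact h i hi

/-- The increments of `x` along `p`, starting with the value `x (p 0)` itself. -/
def increment (x : ℕ → ℝ) (p : ℕ → ℕ) : ℕ → ℝ
  | 0 => x (p 0)
  | i + 1 => x (p (i + 1)) - x (p i)

theorem sum_increment_sq (x : ℕ → ℝ) (p : ℕ → ℕ) (k : ℕ) :
    ∑ i ∈ Finset.range (k + 1), increment x p i ^ 2 =
      x (p 0) ^ 2 + ∑ i ∈ Finset.range k, (x (p (i + 1)) - x (p i)) ^ 2 := by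
  rw [Finset.sum_range_succ', add_comm]
  rfl

theorem sum_sq_comp_le {x : ℕ → ℝ} (hx : (Function.support x).Finite) {p : ℕ → ℕ}
    (hp : Function.Injective p) (s : Finset ℕ) :
    ∑ i ∈ s, x (p i) ^ 2 ≤ ∑ n ∈ hx.toFinset, x n ^ 2 := by
  rw [← Finset.sum_image (f := fun n => x n ^ 2) hp.injOn]
  rw [← Finset.sum_filter_ne_zero]
  refine Finset.sum_le_sum_of_subset_of_nonneg (fun n hn => ?_) fun n _ _ => sq_nonneg _
  simpa using (Finset.mem_filter.mp hn).2

theorem bddAbove_jamesNorm {x : ℕ → ℝ} (hx : (Function.support x).Finite) :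
    BddAbove {r : ℝ | ∃ (k : ℕ) (p : ℕ → ℕ), StrictMono p ∧
      r = √((x (p 0)) ^ 2 + ∑ i ∈ Finset.range k, (x (p (i + 1)) - x (p i)) ^ 2)} := by
  refine ⟨√(5 * ∑ n ∈ hx.toFinset, x n ^ 2), ?_⟩
  rintro r ⟨k, p, hp, rfl⟩
  refine Real.sqrt_le_sqrt ?_
  have hfirst := sum_sq_comp_le hx hp.injective {0}
  have hleft := sum_sq_comp_le hx hp.injective (Finset.range k)
  have hright := sum_sq_comp_le hx (hp.injective.comp Nat.succ_injective) (Finset.range k)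
  have hdiff : ∑ i ∈ Finset.range k, (x (p (i + 1)) - x (p i)) ^ 2 ≤
      2 * ∑ i ∈ Finset.range k, x (p (i + 1)) ^ 2 + 2 * ∑ i ∈ Finset.range k, x (p i) ^ 2 := by
    rw [Finset.mul_sum, Finset.mul_sum, ← Finset.sum_add_distrib]
    exact Finset.sum_le_sum fun i _ => by nlinarith [sq_nonneg (x (p (i + 1)) + x (p i))]
  simp only [Finset.sum_singleton, Function.comp_apply, Nat.succ_eq_add_one] at hfirst hright
  linarith

theorem sqrt_sum_increment_sq_le_jamesNorm {x : ℕ → ℝ} (hx : (Function.support x).Finite)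
    {p : ℕ → ℕ} (hp : StrictMono p) (k : ℕ) :
    √(∑ i ∈ Finset.range (k + 1), increment x p i ^ 2) ≤ jamesNorm x :=
  le_csSup (bddAbove_jamesNorm hx) ⟨k, p, hp, by rw [sum_increment_sq]⟩

theorem abs_le_iSup_abs {x : ℕ → ℝ} (hx : (Function.support x).Finite) (n : ℕ) :
    |x n| ≤ ⨆ m, |x m| := by
  refine le_ciSup (f := fun m => |x m|) (Set.Finite.bddAbove ?_) n
  refine ((hx.image fun m => |x m|).insert 0).subset ?_
  rintro _ ⟨m, rfl⟩
  by_cases hm : x m = 0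
  · simp [hm]
  · exact Or.inr ⟨m, hm, rfl⟩

/-- For all finitely supported sequences `a`, `b` of real numbers, the coordinatewise
product `a ⋆ b` satisfies `‖a ⋆ b‖_J ≤ ‖a‖_J ‖b‖_∞ + ‖a‖_∞ ‖b‖_J`,
where `‖x‖_∞ = ⨆ n, |x n|` is the supremum norm. -/
theorem jamesNorm_star_le (a b : ℕ → ℝ)
    (ha : (Function.support a).Finite) (hb : (Function.support b).Finite) :
    jamesNorm (fun n => a n * b n) ≤
      jamesNorm a * (⨆ n, |b n|) + (⨆ n, |a n|) * jamesNorm b := by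
  have hA := abs_le_iSup_abs ha
  have hB := abs_le_iSup_abs hb
  have hA0 := (abs_nonneg _).trans (hA 0)
  have hB0 := (abs_nonneg _).trans (hB 0)
  refine csSup_le ⟨_, 0, id, strictMono_id, rfl⟩ ?_
  rintro r ⟨k, p, hp, rfl⟩
  rw [← sum_increment_sq (fun n => a n * b n)]
  let u : ℕ → ℝ := fun i => increment a p i * b (p i)
  let v : ℕ → ℝ
    | 0 => 0
    | i + 1 => a (p i) * increment b p (i + 1)
  have huv : ∀ i, increment (fun n => a n * b n) p i = u i + v i := by
    rintro (_ | i) <;> simp only [u, v, increment] <;> ring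
  have hu : ∀ i ∈ Finset.range (k + 1), |u i| ≤ (⨆ n, |b n|) * |increment a p i| := by
    intro i _
    rw [abs_mul, mul_comm]
    exact mul_le_mul_of_nonneg_right (hB _) (abs_nonneg _)
  have hv : ∀ i ∈ Finset.range (k + 1), |v i| ≤ (⨆ n, |a n|) * |increment b p i| := by
    rintro (_ | i) _
    · simp only [v, abs_zero]
      positivity
    · simp only [v, abs_mul]
      exact mul_le_mul_of_nonneg_right (hA _) (abs_nonneg _)
  simp only [huv]
  calc √(∑ i ∈ Finset.range (k + 1), (u i + v i) ^ 2)
      ≤ √(∑ i ∈ Finset.range (k + 1), u i ^ 2) + √(∑ i ∈ Finset.range (k + 1), v i ^ 2) :=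
        sqrt_sum_add_sq_le _ u v
    _ ≤ (⨆ n, |b n|) * √(∑ i ∈ Finset.range (k + 1), increment a p i ^ 2) +
          (⨆ n, |a n|) * √(∑ i ∈ Finset.range (k + 1), increment b p i ^ 2) :=
        add_le_add (sqrt_sum_sq_le_mul _ _ _ hB0 hu) (sqrt_sum_sq_le_mul _ _ _ hA0 hv)
    _ ≤ (⨆ n, |b n|) * jamesNorm a + (⨆ n, |a n|) * jamesNorm b := by
        gcongr
        · exact sqrt_sum_increment_sq_le_jamesNorm ha hp k
        · exact sqrt_sum_increment_sq_le_jamesNorm hb hp k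
    _ = jamesNorm a * (⨆ n, |b n|) + (⨆ n, |a n|) * jamesNorm b := by rw [mul_comm]
end

section
/- For every k ≥ 2 and all real numbers λ_1, …, λ_{k−1}, the weighted sequence ((2^{k−1}−1)/2^{k−1} · λ_1, (2^{k−2}−1)/2^{k−2} · λ_2, …, (2−1)/2 · λ_{k−1}, 0, 0, …) has James norm at most 2 · ‖(λ_1, …, λ_{k−1}, 0, 0, …)‖_J. -/
/-- The James variation sums of a sequence vanishing from some index on are bounded. -/
lemma bddAbove_jamesNorm_set {x : ℕ → ℝ} {K : ℕ} (hx : ∀ j, K ≤ j → x j = 0) :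
    BddAbove {r : ℝ | ∃ (k : ℕ) (p : ℕ → ℕ), StrictMono p ∧
      r = Real.sqrt ((x (p 0)) ^ 2 + ∑ i ∈ Finset.range k, (x (p (i + 1)) - x (p i)) ^ 2)} := by
  set S : ℝ := ∑ j ∈ Finset.range K, x j ^ 2
  have sum_le (s : Finset ℕ) : ∑ j ∈ s, x j ^ 2 ≤ S := by
    rw [← Finset.sum_filter_of_ne (p := (· < K))]
    · refine Finset.sum_le_sum_of_subset_of_nonneg (fun j hj => ?_) fun _ _ _ => sq_nonneg _
      simpa using (Finset.mem_filter.1 hj).2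
    · intro j _ hj
      by_contra h
      exact hj (by simp [hx j (not_lt.1 h)])
  have sum_comp_le (n : ℕ) (q : ℕ → ℕ) (hq : StrictMono q) :
      ∑ i ∈ Finset.range n, x (q i) ^ 2 ≤ S := by
    rw [← Finset.sum_image (f := fun j => x j ^ 2) hq.injective.injOn]
    exact sum_le _
  refine ⟨√(5 * S), ?_⟩
  rintro _ ⟨k, p, hp, rfl⟩
  refine Real.sqrt_le_sqrt ?_
  have h₀ : x (p 0) ^ 2 ≤ S := by simpa using sum_comp_le 1 p hp
  have h₁ := sum_comp_le k p hp
  have h₂ := sum_comp_le k (fun i => p (i + 1)) fun _ _ h => hp (Nat.succ_lt_succ h)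
  have h₃ : ∑ i ∈ Finset.range k, (x (p (i + 1)) - x (p i)) ^ 2 ≤
      ∑ i ∈ Finset.range k, (2 * x (p (i + 1)) ^ 2 + 2 * x (p i) ^ 2) :=
    Finset.sum_le_sum fun i _ => by nlinarith [sq_nonneg (x (p (i + 1)) + x (p i))]
  rw [Finset.sum_add_distrib, ← Finset.mul_sum, ← Finset.mul_sum] at h₃
  linarith

lemma jamesNorm_nonneg (x : ℕ → ℝ) : 0 ≤ jamesNorm x := by
  refine Real.sSup_nonneg ?_
  rintro _ ⟨k, p, -, rfl⟩
  exact Real.sqrt_nonneg _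

lemma variation_le_jamesNorm_sq {x : ℕ → ℝ} {K : ℕ} (hx : ∀ j, K ≤ j → x j = 0)
    (k : ℕ) {p : ℕ → ℕ} (hp : StrictMono p) :
    x (p 0) ^ 2 + ∑ i ∈ Finset.range k, (x (p (i + 1)) - x (p i)) ^ 2 ≤ jamesNorm x ^ 2 :=
  (Real.sqrt_le_left (jamesNorm_nonneg x)).1
    (le_csSup (bddAbove_jamesNorm_set hx) ⟨k, p, hp, rfl⟩)

lemma sq_apply_le_jamesNorm_sq {x : ℕ → ℝ} {K : ℕ} (hx : ∀ j, K ≤ j → x j = 0) (j : ℕ) :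
    x j ^ 2 ≤ jamesNorm x ^ 2 := by
  simpa using variation_le_jamesNorm_sq hx 0 (p := (· + j)) fun _ _ h => Nat.add_lt_add_right h j

/-- Multiplying a finitely supported sequence by nonincreasing weights in `[0, 1]` increases the
James norm by a factor of at most `√2`. -/
lemma jamesNorm_mul_le {w x : ℕ → ℝ} {K : ℕ} (hw : Antitone w) (hw₀ : ∀ j, 0 ≤ w j)
    (hw₁ : ∀ j, w j ≤ 1) (hx : ∀ j, K ≤ j → x j = 0) :
    jamesNorm (fun j => w j * x j) ≤ √2 * jamesNorm x := by
  refine Real.sSup_le ?_ (mul_nonneg (Real.sqrt_nonneg _) (jamesNorm_nonneg x))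
  rintro _ ⟨k, p, hp, rfl⟩
  refine Real.sqrt_le_iff.2 ⟨mul_nonneg (Real.sqrt_nonneg _) (jamesNorm_nonneg x), ?_⟩
  rw [mul_pow (√2), Real.sq_sqrt zero_le_two]
  set N := jamesNorm x
  have term_le (a b u v : ℝ) (hv : 0 ≤ v) (hvu : v ≤ u) (hu : u ≤ 1) (ha : a ^ 2 ≤ N ^ 2) :
      (v * b - u * a) ^ 2 ≤ (b - a) ^ 2 + (u - v) * N ^ 2 := by
    have convex : (v * (b - a) - (u - v) * a) ^ 2 ≤ v * (b - a) ^ 2 + (u - v) * a ^ 2 := by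
      nlinarith [mul_nonneg (mul_nonneg hv (sub_nonneg.2 hvu)) (sq_nonneg b),
        mul_nonneg (mul_nonneg hv (sub_nonneg.2 hu)) (sq_nonneg (b - a)),
        mul_nonneg (mul_nonneg (sub_nonneg.2 hvu) (sub_nonneg.2 hu)) (sq_nonneg a)]
    have h₁ := mul_le_mul_of_nonneg_right (hvu.trans hu) (sq_nonneg (b - a))
    have h₂ := mul_le_mul_of_nonneg_left ha (sub_nonneg.2 hvu)
    calc (v * b - u * a) ^ 2 = (v * (b - a) - (u - v) * a) ^ 2 := by ring
      _ ≤ _ := by linarith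
  have sum_le : ∑ i ∈ Finset.range k, (w (p (i + 1)) * x (p (i + 1)) - w (p i) * x (p i)) ^ 2 ≤
      ∑ i ∈ Finset.range k, ((x (p (i + 1)) - x (p i)) ^ 2 +
        (w (p i) - w (p (i + 1))) * N ^ 2) :=
    Finset.sum_le_sum fun i _ => term_le _ _ _ _ (hw₀ _) (hw (hp.monotone i.le_succ)) (hw₁ _)
      (sq_apply_le_jamesNorm_sq hx _)
  rw [Finset.sum_add_distrib, ← Finset.sum_mul, Finset.sum_range_sub' (fun i => w (p i))] at sum_le
  have h₀ : (w (p 0) * x (p 0)) ^ 2 ≤ x (p 0) ^ 2 := by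
    rw [mul_pow]
    exact mul_le_of_le_one_left (sq_nonneg _) (pow_le_one₀ (hw₀ _) (hw₁ _))
  have h₁ : (w (p 0) - w (p k)) * N ^ 2 ≤ N ^ 2 :=
    mul_le_of_le_one_left (sq_nonneg _) (by linarith [hw₀ (p k), hw₁ (p 0)])
  linarith [variation_le_jamesNorm_sq hx k hp]

/-- For every `k ≥ 2` and all reals `λ_1, …, λ_{k−1}` (given as `lam 0, …, lam (k-2)`),
the weighted sequence `((2^{k−1}−1)/2^{k−1}·λ_1, (2^{k−2}−1)/2^{k−2}·λ_2, …, (2−1)/2·λ_{k−1},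
0, 0, …)` has James norm at most `2 · ‖(λ_1, …, λ_{k−1}, 0, 0, …)‖_J`.
(In `0`-based indexing, the entry at position `j < k − 1` carries the weight
`(2^{k−1−j} − 1)/2^{k−1−j}`.) -/
theorem jamesNorm_weighted_le (k : ℕ) (hk : 2 ≤ k) (lam : ℕ → ℝ) :
    jamesNorm (fun j => if j < k - 1 then
        (((2 : ℝ) ^ (k - 1 - j) - 1) / (2 : ℝ) ^ (k - 1 - j)) * lam j else 0) ≤
      2 * jamesNorm (fun j => if j < k - 1 then lam j else 0) := by
  set x : ℕ → ℝ := fun j => if j < k - 1 then lam j else 0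
  have hx : ∀ j, k - 1 ≤ j → x j = 0 := fun j hj => if_neg hj.not_gt
  have pow_le_one (n : ℕ) : (1 / 2 : ℝ) ^ n ≤ 1 := pow_le_one₀ (by norm_num) (by norm_num)
  have weighted_eq : (fun j => if j < k - 1 then
      (((2 : ℝ) ^ (k - 1 - j) - 1) / (2 : ℝ) ^ (k - 1 - j)) * lam j else 0) =
      fun j => (1 - (1 / 2 : ℝ) ^ (k - 1 - j)) * x j := by
    funext j
    by_cases hj : j < k - 1
    · simp [x, hj, sub_div]
    · simp [x, hj]
  rw [weighted_eq]
  calc _ ≤ √2 * jamesNorm x := jamesNorm_mul_le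
        (fun i j hij => sub_le_sub_left
          (pow_le_pow_of_le_one (by norm_num) (by norm_num) (by omega)) _)
        (fun _ => sub_nonneg.2 (pow_le_one _)) (fun _ => sub_le_self _ (by positivity)) hx
    _ ≤ 2 * jamesNorm x := mul_le_mul_of_nonneg_right
        (Real.sqrt_le_iff.2 ⟨by norm_num, by norm_num⟩) (jamesNorm_nonneg x)
end

section
/- Let (f_n) be a sequence of continuous real-valued functions on [0,1] and g_n(a,b) = f_n(a)·max(0, 1 − 2ⁿ b) on K = [0,1]². Then for every n ≥ 2 and all real numbers λ_1, …, λ_n, the supremum norm of λ_1 g_1 + ⋯ + λ_n g_n over K equals the maximum of ‖λ_1 f_1 + ⋯ + λ_n f_n‖_∞ and max_{2 ≤ k ≤ n} ‖ Σ_{i=1}^{k−1} λ_i · ((2^{k−i}−1)/2^{k−i}) · f_i ‖_∞, where ‖·‖_∞ denotes the supremum norm on C[0,1]. -/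
open unitInterval

/-- `g_n ∈ C(K)`, `K = [0,1]²`, given by `g_n(a,b) = f_n(a) · max(0, 1 − 2ⁿ b)`. -/
noncomputable def gMap (f : ℕ → C(I, ℝ)) (n : ℕ) : C(I × I, ℝ) :=
  ⟨fun p => f n p.1 * max 0 (1 - 2 ^ n * (p.2 : ℝ)), by fun_prop⟩

/-- The linear combination `∑ cᵢ · max(0, 1 − 2ⁱ b)` of the tent functions. -/
noncomputable def tentSum (c : ℕ → ℝ) (n : ℕ) (b : ℝ) : ℝ :=
  ∑ i ∈ Finset.Icc 1 n, c i * max 0 (1 - 2 ^ i * b)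

theorem tentSum_zero (c : ℕ → ℝ) (n : ℕ) : tentSum c n 0 = ∑ i ∈ Finset.Icc 1 n, c i := by
  simp [tentSum]

theorem tentSum_inv_two_pow (c : ℕ → ℝ) {n k : ℕ} (hk : k ≤ n) :
    tentSum c n ((2 : ℝ) ^ k)⁻¹ =
      ∑ i ∈ Finset.Icc 1 (k - 1), c i * (((2 : ℝ) ^ (k - i) - 1) / (2 : ℝ) ^ (k - i)) := by
  have hsub : Finset.Icc 1 (k - 1) ⊆ Finset.Icc 1 n :=
    Finset.Icc_subset_Icc le_rfl (by omega)
  rw [tentSum, ← Finset.sum_subset hsub]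
  · refine Finset.sum_congr rfl fun i hi => ?_
    rw [Finset.mem_Icc] at hi
    obtain ⟨j, rfl⟩ : ∃ j, k = i + j := ⟨k - i, by omega⟩
    have hj : (1 : ℝ) ≤ 2 ^ j := one_le_pow₀ (by norm_num)
    have h : (1 : ℝ) - 2 ^ i * (2 ^ (i + j))⁻¹ = (2 ^ j - 1) / 2 ^ j := by
      rw [pow_add]
      field_simp
    rw [h, Nat.add_sub_cancel_left, max_eq_right (div_nonneg (by linarith) (by positivity))]
  · intro i hi hi'
    rw [Finset.mem_Icc] at hi hi'
    have h : (2 : ℝ) ^ k ≤ 2 ^ i := pow_le_pow_right₀ (by norm_num) (by omega)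
    have h' : 1 ≤ (2 : ℝ) ^ i * (2 ^ k)⁻¹ := by
      rw [← div_eq_mul_inv, le_div_iff₀ (by positivity)]
      linarith
    rw [max_eq_left (by linarith), mul_zero]

theorem abs_tentSum_le_of_mem_Icc {c : ℕ → ℝ} {n : ℕ} {x y b M : ℝ} (hxy : x < y)
    (hb : b ∈ Set.Icc x y)
    (hbreak : ∀ i ∈ Finset.Icc 1 n, 2 ^ i * y ≤ 1 ∨ 1 ≤ 2 ^ i * x)
    (hx : |tentSum c n x| ≤ M) (hy : |tentSum c n y| ≤ M) : |tentSum c n b| ≤ M := by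
  obtain ⟨u, v, hu, hv, huv, rfl⟩ : b ∈ segment ℝ x y := by rwa [segment_eq_Icc hxy.le]
  have key : tentSum c n (u • x + v • y) = u * tentSum c n x + v * tentSum c n y := by
    simp only [tentSum, Finset.mul_sum, ← Finset.sum_add_distrib]
    refine Finset.sum_congr rfl fun i hi => ?_
    have hp : (0 : ℝ) < 2 ^ i := by positivity
    have h₁ := mul_le_mul_of_nonneg_left hb.1 hp.le
    have h₂ := mul_le_mul_of_nonneg_left hb.2 hp.le
    have h₃ := mul_le_mul_of_nonneg_left hxy.le hp.le
    rcases hbreak i hi with h | h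
    · rw [max_eq_right (by linarith), max_eq_right (by linarith), max_eq_right (by linarith)]
      simp only [smul_eq_mul]
      linear_combination -c i * huv
    · rw [max_eq_left (by linarith), max_eq_left (by linarith), max_eq_left (by linarith)]
      ring
  rw [key]
  rw [abs_le] at *
  constructor <;> nlinarith

theorem abs_tentSum_le {c : ℕ → ℝ} {n : ℕ} {M : ℝ} (h0 : |tentSum c n 0| ≤ M)
    (hM : ∀ k ∈ Finset.Icc 2 n, |tentSum c n ((2 : ℝ) ^ k)⁻¹| ≤ M) {b : ℝ} (hb : 0 ≤ b) :
    |tentSum c n b| ≤ M := by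
  have hM0 : 0 ≤ M := (abs_nonneg _).trans h0
  have hnode : ∀ k ∈ Finset.Icc 1 n, |tentSum c n ((2 : ℝ) ^ k)⁻¹| ≤ M := by
    intro k hk
    rw [Finset.mem_Icc] at hk
    rcases hk.1.eq_or_lt with rfl | h
    · rw [tentSum_inv_two_pow c hk.2]
      simpa using hM0
    · exact hM k (Finset.mem_Icc.mpr ⟨h, hk.2⟩)
  have hlarge : ∀ k, k + 1 ≤ n → ∀ b : ℝ, ((2 : ℝ) ^ (k + 1))⁻¹ ≤ b → |tentSum c n b| ≤ M := by
    intro k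
    induction k with
    | zero =>
      intro _ b hb
      have hzero : tentSum c n b = 0 := by
        refine Finset.sum_eq_zero fun i hi => ?_
        have h : (2 : ℝ) ^ 1 ≤ 2 ^ i :=
          pow_le_pow_right₀ (by norm_num) (Finset.mem_Icc.mp hi).1
        norm_num at h hb
        rw [max_eq_left (by nlinarith), mul_zero]
      simpa [hzero] using hM0
    | succ k ih =>
      intro hk b hb
      rcases le_total ((2 : ℝ) ^ (k + 1))⁻¹ b with h | h
      · exact ih (by omega) b h
      · refine abs_tentSum_le_of_mem_Icc ?_ ⟨hb, h⟩ ?_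
          (hnode (k + 1 + 1) (Finset.mem_Icc.mpr ⟨by omega, hk⟩))
          (hnode (k + 1) (Finset.mem_Icc.mpr ⟨by omega, by omega⟩))
        · gcongr <;> norm_num
        · intro i _
          simp only [← div_eq_mul_inv]
          rcases le_or_gt i (k + 1) with hi | hi
          · exact .inl (div_le_one_of_le₀ (pow_le_pow_right₀ (by norm_num) hi) (by positivity))
          · exact .inr ((one_le_div₀ (by positivity)).mpr
              (pow_le_pow_right₀ (by norm_num) (by omega)))
  rcases n with _ | n
  · simpa [tentSum] using hM0
  rcases le_total ((2 : ℝ) ^ (n + 1))⁻¹ b with h | h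
  · exact hlarge n le_rfl b h
  · refine abs_tentSum_le_of_mem_Icc (by positivity) ⟨hb, h⟩ ?_ h0
      (hnode (n + 1) (Finset.mem_Icc.mpr ⟨by omega, le_rfl⟩))
    intro i hi
    rw [← div_eq_mul_inv]
    exact .inl (div_le_one_of_le₀
      (pow_le_pow_right₀ (by norm_num) (Finset.mem_Icc.mp hi).2) (by positivity))

theorem sum_smul_gMap_apply (f : ℕ → C(I, ℝ)) (n : ℕ) (lam : ℕ → ℝ) (a b : I) :
    (∑ i ∈ Finset.Icc 1 n, lam i • gMap f i) (a, b) =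
      tentSum (fun i => lam i * f i a) n b := by
  simp [tentSum, gMap, ContinuousMap.sum_apply, mul_assoc]

/-- Let `(f_n)` be a sequence of continuous real-valued functions on `[0,1]` and
`g_n(a,b) = f_n(a)·max(0, 1 − 2ⁿ b)` on `K = [0,1]²`.  For every `n ≥ 2` and all reals
`λ_1, …, λ_n`, the supremum norm of `λ_1 g_1 + ⋯ + λ_n g_n` over `K` equals the maximum of
`‖λ_1 f_1 + ⋯ + λ_n f_n‖_∞` and `max_{2 ≤ k ≤ n} ‖∑_{i=1}^{k−1} λ_i·((2^{k−i}−1)/2^{k−i})·f_i‖_∞`. -/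
theorem norm_gMap_sum_eq (f : ℕ → C(I, ℝ)) (n : ℕ) (hn : 2 ≤ n) (lam : ℕ → ℝ) :
    ‖∑ i ∈ Finset.Icc 1 n, lam i • gMap f i‖ =
      max ‖∑ i ∈ Finset.Icc 1 n, lam i • f i‖
        ((Finset.Icc 2 n).sup' (Finset.nonempty_Icc.mpr hn) fun k =>
          ‖∑ i ∈ Finset.Icc 1 (k - 1),
            (lam i * (((2 : ℝ) ^ (k - i) - 1) / (2 : ℝ) ^ (k - i))) • f i‖) := by
  have hzero : ∀ a, (∑ i ∈ Finset.Icc 1 n, lam i • f i) a =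
      tentSum (fun i => lam i * f i a) n 0 := fun a => by
    simp [tentSum_zero, ContinuousMap.sum_apply]
  have hnode : ∀ k ≤ n, ∀ a, (∑ i ∈ Finset.Icc 1 (k - 1),
      (lam i * (((2 : ℝ) ^ (k - i) - 1) / (2 : ℝ) ^ (k - i))) • f i) a =
      tentSum (fun i => lam i * f i a) n ((2 : ℝ) ^ k)⁻¹ := fun k hk a => by
    simp [tentSum_inv_two_pow _ hk, ContinuousMap.sum_apply, mul_right_comm]
  apply le_antisymm
  · refine (ContinuousMap.norm_le _ (le_max_of_le_left (norm_nonneg _))).mpr ?_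
    rintro ⟨a, b⟩
    rw [sum_smul_gMap_apply, Real.norm_eq_abs]
    refine abs_tentSum_le ?_ (fun k hk => ?_) b.2.1
    · rw [← hzero, ← Real.norm_eq_abs]
      exact le_max_of_le_left (ContinuousMap.norm_coe_le_norm _ a)
    · rw [← hnode k (Finset.mem_Icc.mp hk).2, ← Real.norm_eq_abs]
      refine le_max_of_le_right (le_trans (ContinuousMap.norm_coe_le_norm _ a) ?_)
      exact Finset.le_sup' (fun k => ‖∑ i ∈ Finset.Icc 1 (k - 1),
        (lam i * (((2 : ℝ) ^ (k - i) - 1) / (2 : ℝ) ^ (k - i))) • f i‖) hk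
  · refine max_le ?_ (Finset.sup'_le _ _ fun k hk => ?_)
    · refine (ContinuousMap.norm_le _ (norm_nonneg _)).mpr fun a => ?_
      have h := sum_smul_gMap_apply f n lam a 0
      rw [Set.Icc.coe_zero, ← hzero] at h
      rw [← h]
      exact ContinuousMap.norm_coe_le_norm _ _
    · refine (ContinuousMap.norm_le _ (norm_nonneg _)).mpr fun a => ?_
      have hb : ((2 : ℝ) ^ k)⁻¹ ∈ I :=
        ⟨by positivity, inv_le_one_of_one_le₀ (one_le_pow₀ (by norm_num))⟩
      rw [hnode k (Finset.mem_Icc.mp hk).2, ← sum_smul_gMap_apply f n lam a ⟨_, hb⟩]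
      exact ContinuousMap.norm_coe_le_norm _ _
end

section
/- Let M > 0 and let (f_n) be a sequence of continuous real-valued functions on [0,1] such that (1/M)·‖(λ_1,…,λ_n,0,…)‖_J ≤ ‖λ_1 f_1 + ⋯ + λ_n f_n‖_∞ ≤ M·‖(λ_1,…,λ_n,0,…)‖_J for every n and all reals λ_1, …, λ_n. Define g_n(a,b) = f_n(a)·max(0, 1 − 2ⁿ b) on K = [0,1]². Then the sequence of partial sums (g_1 + g_2 + ⋯ + g_n)_{n∈ℕ} is uniformly bounded in C(K): ‖g_1 + ⋯ + g_n‖_{C(K)} ≤ 2M for all n. -/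
open unitInterval

/-- The James norm of a nonincreasing sequence with values in `[0, 1]` is at most `√2`. -/
theorem jamesNorm_le_sqrt_two_of_antitone {x : ℕ → ℝ} (hx : Antitone x) (h0 : ∀ j, 0 ≤ x j)
    (h1 : ∀ j, x j ≤ 1) : jamesNorm x ≤ √2 := by
  refine Real.sSup_le ?_ (Real.sqrt_nonneg 2)
  rintro r ⟨k, p, hp, rfl⟩
  refine Real.sqrt_le_sqrt ?_
  have hsum : ∑ i ∈ Finset.range k, (x (p (i + 1)) - x (p i)) ^ 2 ≤ x (p 0) - x (p k) := by
    rw [← Finset.sum_range_sub' (fun i => x (p i)) k]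
    refine Finset.sum_le_sum fun i _ => ?_
    have hstep : x (p (i + 1)) ≤ x (p i) := hx (hp.monotone i.le_succ)
    nlinarith [h0 (p (i + 1)), h1 (p i)]
  nlinarith [h0 (p 0), h1 (p 0), h0 (p k)]

/-- Truncating the sequence `max 0 (1 - 2 ^ (j + 1) * b)` after `n` terms gives a James norm of
at most `√2`. -/
theorem jamesNorm_truncated_hat_le (n : ℕ) {b : ℝ} (hb : 0 ≤ b) :
    jamesNorm (fun j => if j < n then max 0 (1 - 2 ^ (j + 1) * b) else 0) ≤ √2 := by
  refine jamesNorm_le_sqrt_two_of_antitone ?_ ?_ ?_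
  · intro i j hij
    dsimp only
    by_cases hj : j < n
    · rw [if_pos hj, if_pos (hij.trans_lt hj)]
      gcongr
      norm_num
    · rw [if_neg hj]
      split_ifs
      exacts [le_max_left _ _, le_rfl]
  · intro j
    split_ifs
    exacts [le_max_left _ _, le_rfl]
  · intro j
    split_ifs
    · exact max_le zero_le_one (sub_le_self _ (by positivity))
    · exact zero_le_one

/-- Let `M > 0` and `(f_n)` be a sequence of continuous real-valued functions on `[0,1]`
such that `(1/M)·‖(λ_1,…,λ_n,0,…)‖_J ≤ ‖λ_1 f_1 + ⋯ + λ_n f_n‖_∞ ≤ M·‖(λ_1,…,λ_n,0,…)‖_J`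
for every `n` and all reals `λ_1, …, λ_n`.  With `g_n(a,b) = f_n(a)·max(0, 1 − 2ⁿ b)`
on `K = [0,1]²`, the sequence of partial sums `(g_1 + ⋯ + g_n)_n` is uniformly bounded
in `C(K)`: `‖g_1 + ⋯ + g_n‖_{C(K)} ≤ 2M` for all `n`. -/
theorem gMap_partial_sums_uniformly_bounded (M : ℝ) (hM : 0 < M) (f : ℕ → C(I, ℝ))
    (hf : ∀ (n : ℕ) (lam : ℕ → ℝ),
      (1 / M) * jamesNorm (fun j => if j < n then lam (j + 1) else 0) ≤
        ‖∑ i ∈ Finset.Icc 1 n, lam i • f i‖ ∧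
      ‖∑ i ∈ Finset.Icc 1 n, lam i • f i‖ ≤
        M * jamesNorm (fun j => if j < n then lam (j + 1) else 0)) :
    ∀ n : ℕ, ‖∑ i ∈ Finset.Icc 1 n, gMap f i‖ ≤ 2 * M := by
  intro n
  refine (ContinuousMap.norm_le _ (by positivity)).2 fun ⟨a, b⟩ => ?_
  set lam : ℕ → ℝ := fun i => max 0 (1 - 2 ^ i * (b : ℝ)) with hlam
  have heval : (∑ i ∈ Finset.Icc 1 n, gMap f i) (a, b) =
      (∑ i ∈ Finset.Icc 1 n, lam i • f i) a := by
    simp [gMap, hlam, mul_comm]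
  have hsqrt : √2 ≤ (2 : ℝ) := Real.sqrt_le_iff.2 (by norm_num)
  calc ‖(∑ i ∈ Finset.Icc 1 n, gMap f i) (a, b)‖
      ≤ ‖∑ i ∈ Finset.Icc 1 n, lam i • f i‖ := heval ▸ ContinuousMap.norm_coe_le_norm _ a
    _ ≤ M * jamesNorm (fun j => if j < n then lam (j + 1) else 0) := (hf n lam).2
    _ ≤ M * 2 := by
        gcongr
        exact (jamesNorm_truncated_hat_le n b.2.1).trans hsqrt
    _ = 2 * M := mul_comm _ _
end

section
/- There exist a compact metric space K, a sequence (h_n) of continuous real-valued functions on K, and a dense open subset U of K such that: (i) the sequence (h_n) is uniformly bounded and converges pointwise on K to a function that is not continuous; (ii) for every u ∈ U there exists N ∈ ℕ with h_m(u) = h_N(u) for all m ≥ N (in particular Σ_{n=1}^∞ |h_{n+1}(u) − h_n(u)| < ∞ for all u ∈ U, and U is a residual subset of K); and (iii) there is no isomorphic embedding of c₀ (the Banach space of real sequences converging to 0, with the supremum norm) into the closed linear span of { h_n : n ∈ ℕ } in C(K); that is, no continuous linear injection from c₀ into that closed linear span has a continuous inverse on its range. -/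
open ZeroAtInfty

/-- `u` has quadratic variation at most `s`, jumps from and to `0` included, as witnessed by the
control function `F`. -/
structure IsControlled (s : ℝ) (u F : ℕ → ℝ) : Prop where
  diff : ∀ p q, p ≤ q → (u q - u p) ^ 2 ≤ F q - F p
  left : ∀ p, 2 * u p ^ 2 ≤ F p
  right : ∀ p, 2 * u p ^ 2 ≤ s - F p

/-- The sequence equal to `u` before `N` and to `v` from `N` on. -/
def splice (N : ℕ) (u v : ℕ → ℝ) (m : ℕ) : ℝ := if m < N then u m else v m

namespace IsControlled

variable {s s' : ℝ} {u v F G : ℕ → ℝ}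

lemma nonneg (h : IsControlled s u F) : 0 ≤ s := by
  linarith [h.left 0, h.right 0, sq_nonneg (u 0)]

lemma zero : IsControlled 0 (fun _ => 0) (fun _ => 0) := by
  constructor <;> intros <;> simp

lemma control_mem (h : IsControlled s u F) (p : ℕ) : F p ∈ Set.Icc 0 s := by
  constructor <;> linarith [h.left p, h.right p, sq_nonneg (u p)]

lemma mono (h : IsControlled s u F) : Monotone F := fun p q hpq => by
  linarith [h.diff p q hpq, sq_nonneg (u q - u p)]

lemma abs_le_one (h : IsControlled 1 u F) (p : ℕ) : |u p| ≤ 1 := by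
  rw [← sq_le_one_iff_abs_le_one]
  linarith [h.left p, h.right p, sq_nonneg (u p)]

lemma const_mul (h : IsControlled s u F) (r : ℝ) :
    IsControlled (r ^ 2 * s) (fun m => r * u m) (fun m => r ^ 2 * F m) where
  diff p q hpq := by
    have := mul_le_mul_of_nonneg_left (h.diff p q hpq) (sq_nonneg r)
    linarith
  left p := by
    have := mul_le_mul_of_nonneg_left (h.left p) (sq_nonneg r)
    linarith
  right p := by
    have := mul_le_mul_of_nonneg_left (h.right p) (sq_nonneg r)
    linarith

lemma splice (h : IsControlled s u F) (h' : IsControlled s' v G) (N : ℕ) :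
    IsControlled (s + s') (splice N u v) (splice N F (fun m => s + G m)) where
  diff p q hpq := by
    unfold _root_.splice
    split_ifs with hq hp hp
    · exact h.diff p q hpq
    · omega
    · linarith [h.right p, h'.left q, sq_nonneg (v q + u p)]
    · linarith [h'.diff p q hpq]
  left p := by
    unfold _root_.splice
    split_ifs
    · exact h.left p
    · linarith [h'.left p, h.nonneg]
  right p := by
    unfold _root_.splice
    split_ifs
    · linarith [h.right p, h'.nonneg]
    · linarith [h'.right p]

lemma exists_tendsto (h : IsControlled s u F) :
    ∃ l, Filter.Tendsto u Filter.atTop (nhds l) := by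
  have hF : Filter.Tendsto F Filter.atTop (nhds (⨆ i, F i)) :=
    tendsto_atTop_ciSup h.mono ⟨s, by rintro _ ⟨p, rfl⟩; exact (h.control_mem p).2⟩
  apply cauchySeq_tendsto_of_complete
  rw [Metric.cauchySeq_iff']
  intro ε hε
  obtain ⟨N, hN⟩ := Metric.cauchySeq_iff'.1 hF.cauchySeq (ε ^ 2) (by positivity)
  refine ⟨N, fun n hn => ?_⟩
  have h1 := hN n hn
  rw [Real.dist_eq] at h1 ⊢
  have h2 := (abs_lt.1 h1).2
  exact abs_lt_of_sq_lt_sq ((h.diff N n hn).trans_lt h2) hε.le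

lemma half_const : IsControlled 1 (fun _ => 1 / 2) (fun _ => 1 / 2) := by
  constructor <;> intros <;> norm_num

end IsControlled

/-- Controlled sequences `u`, together with a control function and a number `t ∈ [0, 1]` such that
`u` vanishes beyond `1 / t`. -/
def controlledSet : Set ((ℕ → ℝ) × (ℕ → ℝ) × ℝ) :=
  {z | IsControlled 1 z.1 z.2.1 ∧ z.2.2 ∈ Set.Icc (0 : ℝ) 1 ∧
    ∀ m : ℕ, z.1 m = 0 ∨ m * z.2.2 ≤ 1}

lemma isClosed_controlledSet : IsClosed controlledSet := by
  have h : controlledSet =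
      (⋂ (p : ℕ) (q : ℕ) (_ : p ≤ q), {z | (z.1 q - z.1 p) ^ 2 ≤ z.2.1 q - z.2.1 p}) ∩
      (⋂ p : ℕ, {z | 2 * z.1 p ^ 2 ≤ z.2.1 p}) ∩
      (⋂ p : ℕ, {z | 2 * z.1 p ^ 2 ≤ 1 - z.2.1 p}) ∩
      ({z | 0 ≤ z.2.2} ∩ {z | z.2.2 ≤ 1}) ∩
      (⋂ m : ℕ, {z | z.1 m = 0} ∪ {z | (m : ℝ) * z.2.2 ≤ 1}) := by
    ext z
    simp only [controlledSet, Set.mem_ofPred_eq, Set.mem_inter_iff, Set.mem_iInter, Set.mem_union,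
      Set.mem_Icc]
    constructor
    · rintro ⟨h, ht, hm⟩
      exact ⟨⟨⟨⟨h.diff, h.left⟩, h.right⟩, ht⟩, hm⟩
    · rintro ⟨⟨⟨⟨h1, h2⟩, h3⟩, ht⟩, hm⟩
      exact ⟨⟨h1, h2, h3⟩, ht, hm⟩
  rw [h]
  refine IsClosed.inter (IsClosed.inter (IsClosed.inter (IsClosed.inter ?_ ?_) ?_) ?_) ?_
  · exact isClosed_iInter fun p => isClosed_iInter fun q => isClosed_iInter fun _ =>
      isClosed_le (by fun_prop) (by fun_prop)
  · exact isClosed_iInter fun p => isClosed_le (by fun_prop) (by fun_prop)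
  · exact isClosed_iInter fun p => isClosed_le (by fun_prop) (by fun_prop)
  · exact (isClosed_le (by fun_prop) (by fun_prop)).inter (isClosed_le (by fun_prop) (by fun_prop))
  · exact isClosed_iInter fun m =>
      (isClosed_eq (by fun_prop) (by fun_prop)).union (isClosed_le (by fun_prop) (by fun_prop))

lemma isCompact_controlledSet : IsCompact controlledSet := by
  refine IsCompact.of_isClosed_subset
    ((isCompact_univ_pi fun _ : ℕ => isCompact_Icc (a := (-1 : ℝ)) (b := 1)).prod
      ((isCompact_univ_pi fun _ : ℕ => isCompact_Icc (a := (0 : ℝ)) (b := 1)).prod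
        (isCompact_Icc (a := (0 : ℝ)) (b := 1)))) isClosed_controlledSet ?_
  rintro z ⟨h, ht, -⟩
  exact ⟨fun p _ => abs_le.1 (h.abs_le_one p), fun p _ => h.control_mem p, ht⟩

/-- The compact metrizable space underlying the counterexample. -/
abbrev ControlledSpace : Type := controlledSet

instance : CompactSpace ControlledSpace := isCompact_iff_compactSpace.1 isCompact_controlledSet

namespace ControlledSpace

/-- The point of `ControlledSpace` given by a controlled sequence, with last coordinate `0`. -/
def mk {u F : ℕ → ℝ} (h : IsControlled 1 u F) : ControlledSpace :=
  ⟨(u, F, 0), h, by simp, fun m => Or.inr (by simp)⟩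

/-- The `m`-th coordinate function. -/
def coord (m : ℕ) : C(ControlledSpace, ℝ) := ⟨fun z => z.1.1 m, by fun_prop⟩

@[simp] lemma coord_apply (m : ℕ) (z : ControlledSpace) : coord m z = z.1.1 m := rfl

/-- The points whose last coordinate is positive. -/
def positivePart : Set ControlledSpace := {z | 0 < z.1.2.2}

lemma isOpen_positivePart : IsOpen positivePart :=
  isOpen_lt (by fun_prop) (by fun_prop)

lemma exists_forall_ge_eq_zero {z : ControlledSpace} (hz : z ∈ positivePart) :
    ∃ N, ∀ m ≥ N, z.1.1 m = 0 := by
  obtain ⟨N, hN⟩ := exists_nat_gt (1 / z.1.2.2)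
  refine ⟨N, fun m hm => (z.2.2.2 m).resolve_right ?_⟩
  rw [not_le]
  have hz' : 0 < z.1.2.2 := hz
  rw [div_lt_iff₀ hz'] at hN
  have : (N : ℝ) ≤ m := by exact_mod_cast hm
  nlinarith

lemma dense_positivePart : Dense positivePart := by
  intro z
  have hc (n : ℕ) : IsControlled 1 (splice n z.1.1 fun _ => 0)
      (splice n z.1.2.1 fun _ => 1) := by
    simpa using z.2.1.splice IsControlled.zero n
  rcases z.2.2.1.1.lt_or_eq with hz | hz
  · exact subset_closure hz
  let w (n : ℕ) : ControlledSpace := ⟨(splice n z.1.1 fun _ => 0, splice n z.1.2.1 fun _ => 1,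
    1 / ((n : ℝ) + 1)), hc n, ⟨by positivity, by
      rw [div_le_one (by positivity)]; linarith [(Nat.cast_nonneg n : (0 : ℝ) ≤ n)]⟩, fun m => by
      by_cases hm : m < n
      · right
        have : (m : ℝ) < n := by exact_mod_cast hm
        rw [mul_one_div, div_le_one (by positivity)]
        linarith
      · left
        simp [splice, hm]⟩
  have hs (u v : ℕ → ℝ) : Filter.Tendsto (fun n => splice n u v) Filter.atTop (nhds u) := by
    refine tendsto_pi_nhds.2 fun m => tendsto_const_nhds.congr' ?_
    filter_upwards [Filter.eventually_gt_atTop m] with n hn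
    simp [splice, hn]
  have hw : Filter.Tendsto w Filter.atTop (nhds z) := by
    refine tendsto_subtype_rng.2 ?_
    refine (hs _ _).prodMk_nhds ((hs _ _).prodMk_nhds ?_)
    rw [← hz]
    exact tendsto_one_div_add_atTop_nhds_zero_nat
  exact mem_closure_of_tendsto hw (Filter.Eventually.of_forall fun n =>
    show (0 : ℝ) < 1 / ((n : ℝ) + 1) by positivity)

lemma isControlled_half_single (j : ℕ) :
    IsControlled 1 (fun m => if m = j then 1 / 2 else 0)
      (fun m => if m < j then 0 else if m = j then 1 / 2 else 1) := by
  constructor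
  · intro p q hpq
    split_ifs <;> first | omega | norm_num
  · intro p
    split_ifs <;> first | omega | norm_num
  · intro p
    split_ifs <;> first | omega | norm_num

/-- The functional reading off the coefficient of `coord j`. -/
noncomputable def coeff (j : ℕ) : C(ControlledSpace, ℝ) →ₗ[ℝ] ℝ where
  toFun x := 2 * x (mk (isControlled_half_single j))
  map_add' x y := by simp [mul_add]
  map_smul' r x := by simp; ring

lemma coeff_apply (j : ℕ) (x : C(ControlledSpace, ℝ)) :
    coeff j x = 2 * x (mk (isControlled_half_single j)) := rfl

lemma coeff_coord (j m : ℕ) : coeff j (coord m) = if m = j then 1 else 0 := by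
  rw [coeff_apply, coord_apply]
  simp only [mk]
  split_ifs <;> norm_num

/-- The closed linear span of the coordinate functions. -/
noncomputable abbrev closedSpan : Submodule ℝ C(ControlledSpace, ℝ) :=
  (Submodule.span ℝ (Set.range coord)).topologicalClosure

lemma apply_eq_sum_coeff {x : C(ControlledSpace, ℝ)} (hx : x ∈ closedSpan)
    {z : ControlledSpace} {N : ℕ} (hz : ∀ m ≥ N, z.1.1 m = 0) :
    x z = ∑ m ∈ Finset.range N, z.1.1 m * coeff m x := by
  have hcl : IsClosed {x : C(ControlledSpace, ℝ) |
      x z = ∑ m ∈ Finset.range N, z.1.1 m * coeff m x} := by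
    simp only [coeff_apply]
    exact isClosed_eq (by fun_prop) (by fun_prop)
  refine closure_minimal ?_ hcl hx
  intro y hy
  induction hy using Submodule.span_induction with
  | mem y hy =>
    obtain ⟨j, rfl⟩ := hy
    simp only [Set.mem_ofPred_eq, coeff_coord, coord_apply, mul_ite, mul_one, mul_zero,
      Finset.sum_ite_eq, Finset.mem_range]
    split_ifs with h
    · rfl
    · exact hz j (not_lt.1 h)
  | zero => simp
  | add a b _ _ ha hb =>
    simp only [Set.mem_ofPred_eq] at ha hb ⊢
    simp only [ContinuousMap.add_apply, map_add, mul_add, Finset.sum_add_distrib, ha, hb]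
  | smul r a _ ha =>
    simp only [Set.mem_ofPred_eq] at ha ⊢
    simp only [ContinuousMap.smul_apply, map_smul, smul_eq_mul, ha, Finset.mul_sum]
    exact Finset.sum_congr rfl fun _ _ => by ring

lemma exists_mem_positivePart_lt {x : C(ControlledSpace, ℝ)} {c : ℝ} (hc : 0 ≤ c)
    (hx : c < ‖x‖) : ∃ z ∈ positivePart, c < |x z| := by
  by_contra! h
  refine hx.not_ge ((ContinuousMap.norm_le x hc).2 fun z => ?_)
  have hcl : IsClosed {z | |x z| ≤ c} := isClosed_le (by fun_prop) (by fun_prop)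
  exact closure_minimal h hcl (dense_positivePart z)

section WeaklyUnconditionallyCauchy

variable {x : ℕ → C(ControlledSpace, ℝ)} {c C : ℝ}

lemma tendsto_apply_zero
    (hC : ∀ (S : Finset ℕ) (ε : ℕ → ℝ), (∀ i, |ε i| ≤ 1) → ‖∑ i ∈ S, ε i • x i‖ ≤ C)
    (z : ControlledSpace) : Filter.Tendsto (fun n => x n z) Filter.atTop (nhds 0) := by
  have hsum : Summable fun n => |x n z| := by
    refine summable_of_sum_le (c := C) (fun _ => abs_nonneg _) fun S => ?_
    have h := hC S (fun i => SignType.sign (x i z)) (fun i => by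
      rcases lt_trichotomy (x i z) 0 with h | h | h <;> simp [h])
    refine le_trans ?_ (((le_abs_self _).trans
      (ContinuousMap.norm_coe_le_norm (∑ i ∈ S, (SignType.sign (x i z) : ℝ) • x i) z)).trans h)
    rw [ContinuousMap.sum_apply]
    refine le_of_eq (Finset.sum_congr rfl fun i _ => ?_)
    simp [sign_mul_self]
  exact tendsto_zero_iff_abs_tendsto_zero _ |>.2 hsum.tendsto_atTop_zero

lemma exists_controlled_combination (hc : 0 < c) (hx : ∀ n, x n ∈ closedSpan)
    (hxc : ∀ n, c ≤ ‖x n‖)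
    (hC : ∀ (S : Finset ℕ) (ε : ℕ → ℝ), (∀ i, |ε i| ≤ 1) → ‖∑ i ∈ S, ε i • x i‖ ≤ C)
    (k : ℕ) :
    ∃ (v G : ℕ → ℝ) (N : ℕ) (S : Finset ℕ) (ε : ℕ → ℝ), IsControlled k v G ∧
      (∀ i, |ε i| ≤ 1) ∧
      k * (c / 2) ≤ ∑ m ∈ Finset.range N, v m * coeff m (∑ i ∈ S, ε i • x i) := by
  induction k with
  | zero =>
    exact ⟨_, _, 0, ∅, fun _ => 0, by simpa using IsControlled.zero, by simp, by simp⟩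
  | succ k ih =>
    obtain ⟨v, G, N, S, ε, hv, hε, hk⟩ := ih
    set y := ∑ i ∈ S, ε i • x i with hy
    have hcoeff (m : ℕ) : Filter.Tendsto (fun n => coeff m (x n)) Filter.atTop (nhds 0) := by
      simpa [coeff_apply] using (tendsto_apply_zero hC (mk (isControlled_half_single m))).const_mul 2
    have h1 : Filter.Tendsto (fun n => ∑ m ∈ Finset.range N, |v m * coeff m (x n)|)
        Filter.atTop (nhds 0) := by
      simpa using tendsto_finsetSum (Finset.range N) fun m _ => ((hcoeff m).const_mul (v m)).abs
    have h2 : Filter.Tendsto (fun n => ∑ m ∈ Finset.range N, |coeff m (x n)|)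
        Filter.atTop (nhds 0) := by
      simpa using tendsto_finsetSum (Finset.range N) fun m _ => (hcoeff m).abs
    obtain ⟨n, hn1, hn2, hnS⟩ := ((h1.eventually_lt_const (by positivity : 0 < c / 8)).and
      ((h2.eventually_lt_const (by positivity : 0 < c / 8)).and
        (Filter.eventually_gt_atTop (S.sup id)))).exists
    have hnS' : n ∉ S := fun h => hnS.not_ge (Finset.le_sup (f := id) h)
    obtain ⟨z, hzU, hz⟩ := exists_mem_positivePart_lt (c := 3 * c / 4) (by positivity)
      (lt_of_lt_of_le (by linarith) (hxc n))
    obtain ⟨M, hM⟩ := exists_forall_ge_eq_zero hzU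
    set u := z.1.1
    have hNM : N ≤ max M N := le_max_right _ _
    rw [apply_eq_sum_coeff (hx n) (N := max M N) fun m hm => hM m ((le_max_left _ _).trans hm),
      ← Finset.sum_range_add_sum_Ico _ hNM] at hz
    set b : C(ControlledSpace, ℝ) → ℝ :=
      fun w => ∑ m ∈ Finset.Ico N (max M N), u m * coeff m w with hb
    have hhead : |∑ m ∈ Finset.range N, u m * coeff m (x n)| < c / 8 := by
      refine lt_of_le_of_lt ((Finset.abs_sum_le_sum_abs _ _).trans
        (Finset.sum_le_sum fun m _ => ?_)) hn2
      rw [abs_mul]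
      exact mul_le_of_le_one_left (abs_nonneg _) (z.2.1.abs_le_one m)
    have hbn : 5 * c / 8 ≤ |b (x n)| := by
      have := abs_add_le (∑ m ∈ Finset.range N, u m * coeff m (x n)) (b (x n))
      linarith
    obtain ⟨σ, hσ, hσy⟩ : ∃ σ : ℝ, σ ^ 2 = 1 ∧ 0 ≤ σ * b y := by
      rcases le_total 0 (b y) with h | h
      · exact ⟨1, by norm_num, by linarith⟩
      · exact ⟨-1, by norm_num, by linarith⟩
    obtain ⟨τ, hτ, hτx⟩ : ∃ τ : ℝ, |τ| = 1 ∧ σ * (τ * b (x n)) = |b (x n)| := by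
      have hσ' : |σ| = 1 := by
        rw [← abs_one, ← sq_eq_sq_iff_abs_eq_abs, hσ, one_pow]
      rcases le_total 0 (b (x n)) with h | h
      · exact ⟨σ, hσ', by rw [abs_of_nonneg h]; linear_combination b (x n) * hσ⟩
      · exact ⟨-σ, by rwa [abs_neg], by rw [abs_of_nonpos h]; linear_combination -b (x n) * hσ⟩
    have hu1 := z.2.1.const_mul σ
    rw [hσ, one_mul] at hu1
    refine ⟨_, _, max M N, insert n S, Function.update ε n τ,
      by simpa using hv.splice hu1 N, fun i => ?_, ?_⟩
    · by_cases hi : i = n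
      · subst hi
        simp [hτ]
      · simpa [hi] using hε i
    have hy' : ∑ i ∈ insert n S, Function.update ε n τ i • x i = τ • x n + y := by
      rw [Finset.sum_insert hnS', Function.update_self, hy]
      congr 1
      refine Finset.sum_congr rfl fun i hi => ?_
      rw [Function.update_of_ne (by rintro rfl; exact hnS' hi)]
    rw [hy', ← Finset.sum_range_add_sum_Ico _ hNM]
    have e1 : ∑ m ∈ Finset.range N, splice N v (fun m => σ * u m) m * coeff m (τ • x n + y) =
        τ * (∑ m ∈ Finset.range N, v m * coeff m (x n)) +
          ∑ m ∈ Finset.range N, v m * coeff m y := by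
      rw [Finset.mul_sum, ← Finset.sum_add_distrib]
      refine Finset.sum_congr rfl fun m hm => ?_
      simp only [splice, Finset.mem_range.1 hm, if_true, map_add, map_smul, smul_eq_mul]
      ring
    have e2 : ∑ m ∈ Finset.Ico N (max M N),
        splice N v (fun m => σ * u m) m * coeff m (τ • x n + y) =
        σ * (τ * b (x n)) + σ * b y := by
      simp only [hb, Finset.mul_sum]
      rw [← Finset.sum_add_distrib]
      refine Finset.sum_congr rfl fun m hm => ?_
      simp only [splice, (Finset.mem_Ico.1 hm).1.not_gt, if_false, map_add, map_smul, smul_eq_mul]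
      ring
    have e3 : |τ * ∑ m ∈ Finset.range N, v m * coeff m (x n)| < c / 8 := by
      rw [abs_mul, hτ, one_mul]
      exact (Finset.abs_sum_le_sum_abs _ _).trans_lt hn1
    rw [e1, e2, hτx]
    push_cast
    linarith [(abs_lt.1 e3).1]

/-- The closed span of the coordinate functions contains no seminormalized weakly unconditionally
Cauchy series. -/
lemma not_weaklyUnconditionallyCauchy (hc : 0 < c) (hx : ∀ n, x n ∈ closedSpan)
    (hxc : ∀ n, c ≤ ‖x n‖) :
    ¬ ∀ (S : Finset ℕ) (ε : ℕ → ℝ), (∀ i, |ε i| ≤ 1) → ‖∑ i ∈ S, ε i • x i‖ ≤ C := by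
  intro hC
  obtain ⟨n, hn⟩ := exists_nat_gt (max 0 (2 * C / c))
  have hn0 : (0 : ℝ) < n := (le_max_left _ _).trans_lt hn
  have hnC : 2 * C < n * c := by
    rw [← div_lt_iff₀ hc]
    exact (le_max_right _ _).trans_lt hn
  obtain ⟨v, G, N, S, ε, hv, hε, hk⟩ := exists_controlled_combination hc hx hxc hC (n ^ 2)
  have hw := (hv.splice IsControlled.zero N).const_mul (n : ℝ)⁻¹
  have hs : (n : ℝ)⁻¹ ^ 2 * (((n ^ 2 : ℕ) : ℝ) + 0) = 1 := by
    push_cast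
    field_simp
    ring
  rw [hs] at hw
  have hy : ∑ i ∈ S, ε i • x i ∈ closedSpan :=
    Submodule.sum_mem _ fun i _ => Submodule.smul_mem _ _ (hx i)
  have h := apply_eq_sum_coeff hy (z := mk hw) (N := N) fun m hm => by
    simp [mk, splice, hm.not_gt]
  have h' : (∑ i ∈ S, ε i • x i) (mk hw) =
      (n : ℝ)⁻¹ * ∑ m ∈ Finset.range N, v m * coeff m (∑ i ∈ S, ε i • x i) := by
    rw [h, Finset.mul_sum]
    refine Finset.sum_congr rfl fun m hm => ?_
    simp only [mk, splice, Finset.mem_range.1 hm, if_true]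
    ring
  have hle : (∑ i ∈ S, ε i • x i) (mk hw) ≤ C :=
    ((le_abs_self _).trans
      (ContinuousMap.norm_coe_le_norm (∑ i ∈ S, ε i • x i) _)).trans (hC S ε hε)
  rw [h', inv_mul_le_iff₀ hn0] at hle
  push_cast at hk
  nlinarith

end WeaklyUnconditionallyCauchy

end ControlledSpace

/-- The finitely supported element of `c₀` agreeing with `ε` on `S`. -/
def finiteZeroAtInfty (S : Finset ℕ) (ε : ℕ → ℝ) : C₀(ℕ, ℝ) where
  toFun i := if i ∈ S then ε i else 0
  continuous_toFun := continuous_of_discreteTopology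
  zero_at_infty' := by
    rw [Filter.cocompact_eq_cofinite]
    refine tendsto_const_nhds.congr' ?_
    filter_upwards [S.finite_toSet.compl_mem_cofinite] with i hi
    exact (if_neg hi).symm

lemma finiteZeroAtInfty_apply (S : Finset ℕ) (ε : ℕ → ℝ) (i : ℕ) :
    finiteZeroAtInfty S ε i = if i ∈ S then ε i else 0 := rfl

lemma norm_finiteZeroAtInfty_le (S : Finset ℕ) {ε : ℕ → ℝ} (hε : ∀ i, |ε i| ≤ 1) :
    ‖finiteZeroAtInfty S ε‖ ≤ 1 := by
  rw [← ZeroAtInftyContinuousMap.norm_toBCF_eq_norm, BoundedContinuousFunction.norm_le zero_le_one]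
  intro i
  change ‖if i ∈ S then ε i else 0‖ ≤ 1
  split_ifs
  · exact hε i
  · simp

lemma one_le_norm_finiteZeroAtInfty_singleton (n : ℕ) :
    1 ≤ ‖finiteZeroAtInfty {n} fun _ => 1‖ := by
  rw [← ZeroAtInftyContinuousMap.norm_toBCF_eq_norm]
  have h := (finiteZeroAtInfty {n} fun _ => 1).toBCF.norm_coe_le_norm n
  refine le_trans ?_ h
  change 1 ≤ ‖if n ∈ ({n} : Finset ℕ) then (1 : ℝ) else 0‖
  simp

lemma finiteZeroAtInfty_eq_sum (S : Finset ℕ) (ε : ℕ → ℝ) :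
    finiteZeroAtInfty S ε = ∑ i ∈ S, ε i • finiteZeroAtInfty {i} fun _ => 1 := by
  induction S using Finset.induction_on with
  | empty => ext i; simp [finiteZeroAtInfty_apply]
  | insert a S ha ih =>
    rw [Finset.sum_insert ha, ← ih]
    ext i
    simp only [finiteZeroAtInfty_apply, ZeroAtInftyContinuousMap.coe_add, Pi.add_apply,
      ZeroAtInftyContinuousMap.coe_smul, Pi.smul_apply, Finset.mem_insert, Finset.mem_singleton,
      smul_eq_mul]
    by_cases hi : i = a
    · subst hi
      simp [ha]
    · simp [hi]

lemma exists_norm_le_of_linear_of_continuous {E F : Type*} [SeminormedAddCommGroup E]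
    [NormedSpace ℝ E] [SeminormedAddCommGroup F] [NormedSpace ℝ F] {f : E → F}
    (hadd : ∀ x y, f (x + y) = f x + f y) (hsmul : ∀ (r : ℝ) x, f (r • x) = r • f x)
    (hf : Continuous f) : ∃ C : ℝ, 0 < C ∧ ∀ x, ‖f x‖ ≤ C * ‖x‖ :=
  let T : E →L[ℝ] F := ⟨⟨⟨f, hadd⟩, hsmul⟩, hf⟩
  T.bound

lemma ControlledSpace.not_exists_boundedBelow :
    ¬ ∃ T : C₀(ℕ, ℝ) →L[ℝ] ControlledSpace.closedSpan,
        Function.Injective T ∧ ∃ c : ℝ, 0 < c ∧ ∀ x, c * ‖x‖ ≤ ‖T x‖ := by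
  rintro ⟨T, -, c, hc, hT⟩
  obtain ⟨C, hC0, hC⟩ : ∃ C : ℝ, 0 < C ∧ ∀ f, ‖T f‖ ≤ C * ‖f‖ :=
    exists_norm_le_of_linear_of_continuous (T.map_add ·) (T.map_smul ·) T.continuous
  refine ControlledSpace.not_weaklyUnconditionallyCauchy (C := C)
    (x := fun n => (T (finiteZeroAtInfty {n} fun _ => 1) : C(ControlledSpace, ℝ))) hc
    (fun n => (T _).2) (fun n => ?_) fun S ε hε => ?_
  · refine le_trans ?_ (hT _)
    exact le_mul_of_one_le_right hc.le (one_le_norm_finiteZeroAtInfty_singleton n)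
  · have h : ∑ i ∈ S, ε i • (T (finiteZeroAtInfty {i} fun _ => 1) : C(ControlledSpace, ℝ)) =
        (T (finiteZeroAtInfty S ε) : C(ControlledSpace, ℝ)) := by
      rw [finiteZeroAtInfty_eq_sum, map_sum]
      simp
    rw [h]
    exact (hC _).trans
      (mul_le_of_le_one_right hC0.le (norm_finiteZeroAtInfty_le S hε))

/-- There exist a compact metric space `K`, a sequence `(h_n)` of continuous real-valued
functions on `K`, and a dense open subset `U` of `K` such that:
(i) `(h_n)` is uniformly bounded and converges pointwise on `K` to a function that is not
continuous;
(ii) for every `u ∈ U` there exists `N` with `h_m(u) = h_N(u)` for all `m ≥ N`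
(in particular `∑_{n} |h_{n+1}(u) − h_n(u)| < ∞` for all `u ∈ U`, and `U` is a residual
subset of `K`); and
(iii) there is no isomorphic embedding of `c₀` (here `C₀(ℕ, ℝ)`, the real sequences
tending to `0` with the supremum norm) into the closed linear span of `{h_n : n ∈ ℕ}` in
`C(K)`: no continuous linear injection from `c₀` into that closed linear span is bounded
below. -/
theorem exists_counterexample_HOR :
    ∃ (K : Type) (_ : MetricSpace K) (_ : CompactSpace K)
      (h : ℕ → C(K, ℝ)) (U : Set K),
      IsOpen U ∧ Dense U ∧ U ∈ residual K ∧
      (∃ C : ℝ, ∀ n : ℕ, ‖h n‖ ≤ C) ∧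
      (∃ φ : K → ℝ,
        (∀ x : K, Filter.Tendsto (fun n => h n x) Filter.atTop (nhds (φ x))) ∧
        ¬ Continuous φ) ∧
      (∀ u ∈ U, ∃ N : ℕ, ∀ m ≥ N, h m u = h N u) ∧
      (∀ u ∈ U, Summable fun n => |h (n + 1) u - h n u|) ∧
      ¬ ∃ T : C₀(ℕ, ℝ) →L[ℝ]
          (Submodule.span ℝ (Set.range h)).topologicalClosure,
        Function.Injective T ∧ ∃ c : ℝ, 0 < c ∧ ∀ x, c * ‖x‖ ≤ ‖T x‖ := by
  refine ⟨ControlledSpace, TopologicalSpace.metrizableSpaceMetric _, inferInstance,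
    ControlledSpace.coord, ControlledSpace.positivePart, ControlledSpace.isOpen_positivePart,
    ControlledSpace.dense_positivePart,
    residual_of_dense_open ControlledSpace.isOpen_positivePart ControlledSpace.dense_positivePart,
    ⟨1, fun n => (ContinuousMap.norm_le _ zero_le_one).2 fun z => z.2.1.abs_le_one n⟩,
    ?_, fun u hu => ?_, fun u hu => ?_, ControlledSpace.not_exists_boundedBelow⟩
  · choose φ hφ using fun z : ControlledSpace => z.2.1.exists_tendsto
    refine ⟨φ, hφ, fun hcont => ?_⟩
    have h0 : Set.EqOn φ (fun _ => 0) ControlledSpace.positivePart := fun z hz => by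
      obtain ⟨N, hN⟩ := ControlledSpace.exists_forall_ge_eq_zero hz
      refine tendsto_nhds_unique (hφ z) (tendsto_const_nhds.congr' ?_)
      filter_upwards [Filter.eventually_ge_atTop N] with m hm
      exact (hN m hm).symm
    have h1 := congrFun (hcont.ext_on ControlledSpace.dense_positivePart continuous_const h0)
      (ControlledSpace.mk IsControlled.half_const)
    have h2 := tendsto_nhds_unique (hφ (ControlledSpace.mk IsControlled.half_const))
      (tendsto_const_nhds (x := (1 / 2 : ℝ)))
    rw [h1] at h2
    norm_num at h2
  · obtain ⟨N, hN⟩ := ControlledSpace.exists_forall_ge_eq_zero hu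
    exact ⟨N, fun m hm => (hN m hm).trans (hN N le_rfl).symm⟩
  · obtain ⟨N, hN⟩ := ControlledSpace.exists_forall_ge_eq_zero hu
    refine summable_of_ne_finset_zero (s := Finset.range N) fun m hm => ?_
    have hm' : N ≤ m := by simpa using hm
    simp [hN m hm', hN (m + 1) (by omega)]
end

section
/- Let M > 0 and let (f_n) be a sequence of continuous real-valued functions on [0,1] such that (1/M)·‖(λ_1,…,λ_n,0,…)‖_J ≤ ‖λ_1 f_1 + ⋯ + λ_n f_n‖_∞ ≤ M·‖(λ_1,…,λ_n,0,…)‖_J for every n and all reals λ_1, …, λ_n. Define g_n(a,b) = f_n(a)·max(0, 1 − 2ⁿ b) on K = [0,1]². Then the sequence of partial sums (g_1 + ⋯ + g_n)_{n∈ℕ} converges pointwise everywhere on K, and its pointwise limit is not a continuous function on K. -/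
open unitInterval

open Finset in
theorem sum_abs_sub_strictMono_le (x : ℕ → ℝ) {p : ℕ → ℕ} (hp : StrictMono p) (k : ℕ) :
    ∑ i ∈ range k, |x (p (i + 1)) - x (p i)| ≤ ∑ j ∈ range (p k), |x (j + 1) - x j| := by
  induction k with
  | zero => simpa using sum_nonneg fun j _ => abs_nonneg (x (j + 1) - x j)
  | succ k ih =>
    have hle : p k ≤ p (k + 1) := (hp k.lt_succ_self).le
    have h := dist_le_Ico_sum_dist x hle
    simp only [Real.dist_eq, abs_sub_comm (x _) (x (_ + 1))] at h
    rw [abs_sub_comm] at h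
    rw [sum_range_succ, ← sum_range_add_sum_Ico _ hle]
    linarith

/-- The elements of the set defining the James norm are controlled by the sup norm and the total
variation. -/
theorem sqrt_james_le {x : ℕ → ℝ} {B V : ℝ} (hB : ∀ j, |x j| ≤ B)
    (hV : ∀ m, ∑ j ∈ Finset.range m, |x (j + 1) - x j| ≤ V) {p : ℕ → ℕ} (hp : StrictMono p)
    (k : ℕ) :
    Real.sqrt ((x (p 0)) ^ 2 + ∑ i ∈ Finset.range k, (x (p (i + 1)) - x (p i)) ^ 2) ≤
      Real.sqrt (B ^ 2 + 2 * B * V) := by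
  have hB0 : 0 ≤ B := (abs_nonneg _).trans (hB 0)
  refine Real.sqrt_le_sqrt (add_le_add (sq_le_sq' (abs_le.1 (hB _)).1 (abs_le.1 (hB _)).2) ?_)
  calc ∑ i ∈ Finset.range k, (x (p (i + 1)) - x (p i)) ^ 2
      ≤ ∑ i ∈ Finset.range k, 2 * B * |x (p (i + 1)) - x (p i)| := by
        refine Finset.sum_le_sum fun i _ => ?_
        rw [← sq_abs, sq]
        refine mul_le_mul_of_nonneg_right ?_ (abs_nonneg _)
        linarith [abs_sub (x (p (i + 1))) (x (p i)), hB (p (i + 1)), hB (p i)]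
    _ = 2 * B * ∑ i ∈ Finset.range k, |x (p (i + 1)) - x (p i)| := by rw [Finset.mul_sum]
    _ ≤ 2 * B * V :=
        mul_le_mul_of_nonneg_left ((sum_abs_sub_strictMono_le x hp k).trans (hV _)) (by positivity)

theorem jamesNorm_le {x : ℕ → ℝ} {B V : ℝ} (hB : ∀ j, |x j| ≤ B)
    (hV : ∀ m, ∑ j ∈ Finset.range m, |x (j + 1) - x j| ≤ V) :
    jamesNorm x ≤ Real.sqrt (B ^ 2 + 2 * B * V) := by
  refine csSup_le ⟨_, 0, id, strictMono_id, rfl⟩ ?_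
  rintro r ⟨k, p, hp, rfl⟩
  exact sqrt_james_le hB hV hp k

theorem abs_le_jamesNorm {x : ℕ → ℝ} {n : ℕ} (hx : ∀ j, n ≤ j → x j = 0) (j : ℕ) :
    |x j| ≤ jamesNorm x := by
  have hsum : ∀ m, ∑ i ∈ Finset.range m, |x i| ≤ ∑ i ∈ Finset.range n, |x i| := by
    intro m
    rw [← Finset.sum_subset (Finset.inter_subset_left (s₁ := Finset.range m)
      (s₂ := Finset.range n))]
    · exact Finset.sum_le_sum_of_subset_of_nonneg Finset.inter_subset_right
        fun _ _ _ => abs_nonneg _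
    · intro i hi hi'
      rw [hx i (by simp_all), abs_zero]
  have hB : ∀ j, |x j| ≤ ∑ i ∈ Finset.range n, |x i| := fun j =>
    (Finset.single_le_sum (f := fun i => |x i|) (fun _ _ => abs_nonneg _)
      (Finset.self_mem_range_succ j)).trans (hsum _)
  have hV : ∀ m, ∑ j ∈ Finset.range m, |x (j + 1) - x j| ≤
      2 * ∑ i ∈ Finset.range n, |x i| := by
    intro m
    calc ∑ j ∈ Finset.range m, |x (j + 1) - x j|
        ≤ ∑ j ∈ Finset.range m, (|x (j + 1)| + |x j|) :=
          Finset.sum_le_sum fun _ _ => abs_sub _ _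
      _ ≤ 2 * ∑ i ∈ Finset.range n, |x i| := by
          rw [Finset.sum_add_distrib]
          have h := hsum (m + 1)
          rw [Finset.sum_range_succ'] at h
          linarith [hsum m, abs_nonneg (x 0)]
  refine le_csSup ⟨Real.sqrt ((∑ i ∈ Finset.range n, |x i|) ^ 2 + 2 * (∑ i ∈ Finset.range n, |x i|) *
    (2 * ∑ i ∈ Finset.range n, |x i|)), ?_⟩ ⟨0, fun i => j + i, fun a b h => by simpa using h, ?_⟩
  · rintro r ⟨k, p, hp, rfl⟩
    exact sqrt_james_le hB hV hp k
  · simp [Real.sqrt_sq_eq_abs]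

theorem sum_abs_sub_step_le (n m : ℕ) :
    ∑ j ∈ Finset.range m, |(if n ≤ j + 1 then (1 : ℝ) else 0) - (if n ≤ j then 1 else 0)| ≤ 1 := by
  have h : ∀ j, |(if n ≤ j + 1 then (1 : ℝ) else 0) - (if n ≤ j then 1 else 0)| =
      (if n ≤ j + 1 then (1 : ℝ) else 0) - (if n ≤ j then 1 else 0) := by
    intro j
    refine abs_of_nonneg ?_
    split_ifs <;> first | omega | norm_num
  simp only [h]
  rw [Finset.sum_range_sub (fun j => if n ≤ j then (1 : ℝ) else 0)]
  split_ifs <;> norm_num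

/-- If the sums of `g` do not settle, there are finitely supported coefficients with values in
`[-1, 1]` and total variation at most `2 * N` on which `g` sums to at least `N * δ`. -/
theorem exists_coeff_of_not_cauchy {g : ℕ → ℝ} {δ : ℝ}
    (h : ∀ n, ∃ n', n ≤ n' ∧
      δ ≤ |∑ j ∈ Finset.range n', g j - ∑ j ∈ Finset.range n, g j|) (N : ℕ) :
    ∃ (n : ℕ) (x : ℕ → ℝ), (∀ j, n ≤ j → x j = 0) ∧ (∀ j, |x j| ≤ 1) ∧
      (∀ m, ∑ j ∈ Finset.range m, |x (j + 1) - x j| ≤ 2 * N) ∧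
      N * δ ≤ ∑ j ∈ Finset.range n, x j * g j := by
  induction N with
  | zero => exact ⟨0, 0, by simp, by simp, by simp, by simp⟩
  | succ N ih =>
    obtain ⟨n, x, hx0, hx1, hxV, hxg⟩ := ih
    obtain ⟨n', hn, hδ⟩ := h n
    obtain ⟨ε, hε, hεδ⟩ : ∃ ε : ℝ, |ε| = 1 ∧
        δ ≤ ε * (∑ j ∈ Finset.range n', g j - ∑ j ∈ Finset.range n, g j) := by
      rcases le_abs.1 hδ with h | h
      · exact ⟨1, by simp, by simpa using h⟩
      · exact ⟨-1, by simp, by simpa using h⟩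
    let u : ℕ → ℕ → ℝ := fun n j => if n ≤ j then 1 else 0
    have hu : ∀ n m, ∑ j ∈ Finset.range m, |u n (j + 1) - u n j| ≤ 1 := sum_abs_sub_step_le
    refine ⟨n', fun j => x j + ε * (u n j - u n' j), ?_, ?_, ?_, ?_⟩
    · intro j hj
      simp [u, hj, hn.trans hj, hx0 j (hn.trans hj)]
    · intro j
      by_cases h1 : n ≤ j
      · by_cases h2 : n' ≤ j <;> simp [u, h1, h2, hx0 j h1, hε]
      · have h2 : ¬ n' ≤ j := fun h2 => h1 (hn.trans h2)
        simpa [u, h1, h2] using hx1 j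
    · intro m
      calc ∑ j ∈ Finset.range m,
            |x (j + 1) + ε * (u n (j + 1) - u n' (j + 1)) - (x j + ε * (u n j - u n' j))|
          ≤ ∑ j ∈ Finset.range m, (|x (j + 1) - x j| +
              (|u n (j + 1) - u n j| + |u n' (j + 1) - u n' j|)) := by
            refine Finset.sum_le_sum fun j _ => ?_
            have e : x (j + 1) + ε * (u n (j + 1) - u n' (j + 1)) - (x j + ε * (u n j - u n' j)) =
              (x (j + 1) - x j) + ε * ((u n (j + 1) - u n j) - (u n' (j + 1) - u n' j)) := by ring
            rw [e]
            refine (abs_add_le _ _).trans (add_le_add le_rfl ?_)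
            rw [abs_mul, hε, one_mul]
            exact abs_sub _ _
        _ ≤ 2 * ((N + 1 : ℕ) : ℝ) := by
            rw [Finset.sum_add_distrib, Finset.sum_add_distrib]
            push_cast
            linarith [hxV m, hu n m, hu n' m]
    · have h1 : ∑ j ∈ Finset.range n, (x j + ε * (u n j - u n' j)) * g j =
          ∑ j ∈ Finset.range n, x j * g j := by
        refine Finset.sum_congr rfl fun j hj => ?_
        have hj := Finset.mem_range.1 hj
        simp [u, hj.not_ge, (hj.trans_le hn).not_ge]
      have h2 : ∑ j ∈ Finset.Ico n n', (x j + ε * (u n j - u n' j)) * g j =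
          ε * (∑ j ∈ Finset.range n', g j - ∑ j ∈ Finset.range n, g j) := by
        rw [← Finset.sum_Ico_eq_sub _ hn, Finset.mul_sum]
        refine Finset.sum_congr rfl fun j hj => ?_
        have hj := Finset.mem_Ico.1 hj
        simp [u, hj.1, hj.2.not_ge, hx0 j hj.1]
      rw [← Finset.sum_range_add_sum_Ico _ hn, h1, h2]
      push_cast
      linarith

theorem cauchySeq_sum_of_le_sqrt_variation {g : ℕ → ℝ} {C : ℝ}
    (h : ∀ (n : ℕ) (x : ℕ → ℝ) (V : ℝ), (∀ j, n ≤ j → x j = 0) → (∀ j, |x j| ≤ 1) →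
      (∀ m, ∑ j ∈ Finset.range m, |x (j + 1) - x j| ≤ V) →
      ∑ j ∈ Finset.range n, x j * g j ≤ C * Real.sqrt (1 + 2 * V)) :
    CauchySeq fun n => ∑ j ∈ Finset.range n, g j := by
  rw [Metric.cauchySeq_iff']
  by_contra! hcon
  obtain ⟨δ, hδ, hcon⟩ := hcon
  obtain ⟨N, hN⟩ := exists_nat_gt (5 * C ^ 2 / δ ^ 2)
  have hN0 : (0 : ℝ) < N := lt_of_le_of_lt (by positivity) hN
  have hN1 : (1 : ℝ) ≤ N := by exact_mod_cast hN0
  obtain ⟨n, x, hx0, hx1, hxV, hxg⟩ := exists_coeff_of_not_cauchy (g := g) (δ := δ) hcon N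
  have hle := pow_le_pow_left₀ (by positivity) (hxg.trans (h n x _ hx0 hx1 hxV)) 2
  rw [mul_pow, mul_pow, Real.sq_sqrt (by positivity)] at hle
  rw [div_lt_iff₀ (by positivity)] at hN
  nlinarith [mul_lt_mul_of_pos_left hN hN0, mul_nonneg (sq_nonneg C) (sub_nonneg.2 hN1)]

theorem gMap_sum_apply (f : ℕ → C(I, ℝ)) (n : ℕ) (p : I × I) :
    (∑ i ∈ Finset.Icc 1 n, gMap f i) p =
      ∑ i ∈ Finset.Icc 1 n, max 0 (1 - 2 ^ i * (p.2 : ℝ)) * f i p.1 := by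
  simp [ContinuousMap.sum_apply, gMap, mul_comm]

theorem tendsto_gMap_sum (f : ℕ → C(I, ℝ)) {m : ℕ} {p : I × I}
    (hm : 1 ≤ 2 ^ (m + 1) * (p.2 : ℝ)) :
    Filter.Tendsto (fun n => (∑ i ∈ Finset.Icc 1 n, gMap f i) p) Filter.atTop
      (nhds (∑ i ∈ Finset.Icc 1 m, max 0 (1 - 2 ^ i * (p.2 : ℝ)) * f i p.1)) := by
  refine tendsto_const_nhds.congr' ?_
  filter_upwards [Filter.eventually_ge_atTop m] with n hn
  rw [gMap_sum_apply]
  refine Finset.sum_subset (Finset.Icc_subset_Icc_right hn) fun i hi hi' => ?_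
  have hi : m + 1 ≤ i := by
    simp only [Finset.mem_Icc] at hi hi'
    omega
  have : (2 : ℝ) ^ (m + 1) * (p.2 : ℝ) ≤ 2 ^ i * (p.2 : ℝ) :=
    mul_le_mul_of_nonneg_right (pow_le_pow_right₀ (by norm_num) hi) p.2.2.1
  rw [max_eq_left (by linarith), zero_mul]

theorem sum_Icc_one_eq_sum_range (F : ℕ → ℝ) (n : ℕ) :
    ∑ i ∈ Finset.Icc 1 n, F i = ∑ j ∈ Finset.range n, F (j + 1) := by
  rw [Finset.range_eq_Ico, Finset.sum_Ico_add' F 0 n 1]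
  rfl

/-- Let `M > 0` and `(f_n)` be a sequence of continuous real-valued functions on `[0,1]`
such that `(1/M)·‖(λ_1,…,λ_n,0,…)‖_J ≤ ‖λ_1 f_1 + ⋯ + λ_n f_n‖_∞ ≤ M·‖(λ_1,…,λ_n,0,…)‖_J`
for every `n` and all reals `λ_1, …, λ_n`.  With `g_n(a,b) = f_n(a)·max(0, 1 − 2ⁿ b)` on
`K = [0,1]²`, the sequence of partial sums `(g_1 + ⋯ + g_n)_n` converges pointwise
everywhere on `K`, and its pointwise limit is not a continuous function on `K`. -/
theorem gMap_partial_sums_pointwise_limit_not_continuous (M : ℝ) (hM : 0 < M)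
    (f : ℕ → C(I, ℝ))
    (hf : ∀ (n : ℕ) (lam : ℕ → ℝ),
      (1 / M) * jamesNorm (fun j => if j < n then lam (j + 1) else 0) ≤
        ‖∑ i ∈ Finset.Icc 1 n, lam i • f i‖ ∧
      ‖∑ i ∈ Finset.Icc 1 n, lam i • f i‖ ≤
        M * jamesNorm (fun j => if j < n then lam (j + 1) else 0)) :
    ∃ φ : I × I → ℝ,
      (∀ p : I × I, Filter.Tendsto (fun n => (∑ i ∈ Finset.Icc 1 n, gMap f i) p)
        Filter.atTop (nhds (φ p))) ∧
      ¬ Continuous φ := by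
  have hpt : ∀ a, CauchySeq fun n => ∑ j ∈ Finset.range n, f (j + 1) a := by
    intro a
    refine cauchySeq_sum_of_le_sqrt_variation (C := M) fun n x V hx0 hx1 hxV => ?_
    have hx : (fun j => if j < n then x (j + 1 - 1) else 0) = x := by
      funext j
      split_ifs with hj
      · simp
      · exact (hx0 j (not_lt.1 hj)).symm
    have hle := (hf n fun i => x (i - 1)).2
    rw [hx] at hle
    have hev := (∑ i ∈ Finset.Icc 1 n, x (i - 1) • f i).norm_coe_le_norm a
    have hsum : (∑ i ∈ Finset.Icc 1 n, x (i - 1) • f i) a =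
        ∑ j ∈ Finset.range n, x j * f (j + 1) a := by
      rw [ContinuousMap.sum_apply, sum_Icc_one_eq_sum_range]
      simp
    rw [hsum] at hev
    have hJ := jamesNorm_le hx1 hxV
    rw [one_pow, mul_one] at hJ
    exact (le_abs_self _).trans (hev.trans (hle.trans (mul_le_mul_of_nonneg_left hJ hM.le)))
  have hconv : ∀ p : I × I, ∃ l, Filter.Tendsto (fun n => (∑ i ∈ Finset.Icc 1 n, gMap f i) p)
      Filter.atTop (nhds l) := by
    intro p
    rcases p.2.2.1.eq_or_lt with hp | hp
    · obtain ⟨l, hl⟩ := cauchySeq_tendsto_of_complete (hpt p.1)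
      refine ⟨l, hl.congr fun n => ?_⟩
      rw [gMap_sum_apply, sum_Icc_one_eq_sum_range]
      simp [← hp]
    · obtain ⟨m, hm⟩ := pow_unbounded_of_one_lt (1 / (p.2 : ℝ)) one_lt_two
      rw [div_lt_iff₀ hp] at hm
      refine ⟨_, tendsto_gMap_sum f (m := m) ?_⟩
      rw [pow_succ]
      linarith
  choose φ hφ using hconv
  refine ⟨φ, hφ, fun hcont => ?_⟩
  have huc := CompactSpace.uniformContinuous_of_continuous hcont
  obtain ⟨δ, hδ, huc⟩ := Metric.uniformContinuous_iff.1 huc (1 / (4 * M)) (by positivity)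
  obtain ⟨m, hm⟩ := exists_pow_lt_of_lt_one hδ (show (1 / 2 : ℝ) < 1 by norm_num)
  have hpow : ∀ k : ℕ, (1 / 2 : ℝ) ^ k ∈ I := fun k =>
    ⟨by positivity, pow_le_one₀ (by norm_num) (by norm_num)⟩
  let b : ℕ → I := fun k => ⟨(1 / 2 : ℝ) ^ k, hpow k⟩
  have hb : ∀ k : ℕ, (2 : ℝ) ^ k * (b k : ℝ) = 1 := fun k => by
    simp [b]
  have hb' : (b (m + 2) : ℝ) = b (m + 1) / 2 := by
    simp only [b]
    ring
  have hb1 : (2 : ℝ) ^ (m + 2) * (b (m + 1) : ℝ) = 2 := by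
    rw [pow_succ, mul_right_comm, hb, one_mul]
  let lam : ℕ → ℝ := fun i =>
    max 0 (1 - 2 ^ i * (b (m + 2) : ℝ)) - max 0 (1 - 2 ^ i * (b (m + 1) : ℝ))
  have heq : ∀ a, φ (a, b (m + 2)) - φ (a, b (m + 1)) =
      (∑ i ∈ Finset.Icc 1 (m + 1), lam i • f i) a := by
    intro a
    rw [tendsto_nhds_unique (hφ (a, b (m + 2)))
        (tendsto_gMap_sum f (m := m + 1) (hb (m + 2)).ge),
      tendsto_nhds_unique (hφ (a, b (m + 1)))
        (tendsto_gMap_sum f (m := m + 1) (by rw [hb1]; norm_num)), ← Finset.sum_sub_distrib]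
    simp [ContinuousMap.sum_apply, lam, sub_mul]
  have hup : ‖∑ i ∈ Finset.Icc 1 (m + 1), lam i • f i‖ ≤ 1 / (4 * M) := by
    rw [ContinuousMap.norm_le _ (by positivity)]
    intro a
    rw [← heq]
    refine (huc ?_).le
    have hb0 : (0 : ℝ) ≤ (1 / 2) ^ m := by positivity
    have hd : |(b (m + 2) : ℝ) - b (m + 1)| < δ := by
      have : (b (m + 2) : ℝ) - b (m + 1) = -((1 / 2) ^ m / 4) := by
        simp only [b]
        ring
      rw [this, abs_neg, abs_of_nonneg (by positivity)]
      linarith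
    simpa [Prod.dist_eq, Subtype.dist_eq, Real.dist_eq, hδ] using hd
  have hlow := (hf (m + 1) lam).1.trans hup
  have hJ := abs_le_jamesNorm (x := fun j => if j < m + 1 then lam (j + 1) else 0) (n := m + 1)
    (fun j hj => by simp [hj.not_gt]) m
  have hlam : lam (m + 1) = 1 / 2 := by
    simp only [lam, hb', mul_div_assoc', hb]
    norm_num
  simp only [Nat.lt_succ_self, if_true, hlam] at hJ
  rw [abs_of_pos (by norm_num)] at hJ
  have h1 : 1 / M * (1 / 2) ≤ 1 / (4 * M) :=
    (mul_le_mul_of_nonneg_left hJ (by positivity)).trans hlow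
  rw [div_mul_div_comm, div_le_div_iff₀ (by positivity) (by positivity)] at h1
  linarith
end

section
/- Let M > 0 and let (f_n) be a sequence of continuous real-valued functions on [0,1] such that (1/M)·‖(λ_1,…,λ_n,0,…)‖_J ≤ ‖λ_1 f_1 + ⋯ + λ_n f_n‖_∞ ≤ M·‖(λ_1,…,λ_n,0,…)‖_J for every n and all reals λ_1, …, λ_n. Define g_n(a,b) = f_n(a)·max(0, 1 − 2ⁿ b) on K = [0,1]². Then the sequence of partial sums (g_1 + ⋯ + g_n)_{n∈ℕ} is weakly Cauchy in C(K) (i.e., (φ(g_1 + ⋯ + g_n))_n converges for every continuous linear functional φ on C(K)) but is not weakly convergent in C(K). -/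
open unitInterval

theorem sum_abs_sub_le_of_antitone {a : ℕ → ℝ} (ha : Antitone a) (h0 : ∀ j, 0 ≤ a j)
    (h1 : ∀ j, a j ≤ 1) {p : ℕ → ℕ} (hp : StrictMono p) (k : ℕ) :
    ∑ i ∈ Finset.range k, |a (p (i + 1)) - a (p i)| ≤ 1 := by
  have h : ∀ i, |a (p (i + 1)) - a (p i)| = a (p i) - a (p (i + 1)) := fun i => by
    rw [abs_sub_comm, abs_of_nonneg (sub_nonneg.2 (ha (hp.monotone (Nat.le_succ i))))]
  simp only [h, Finset.sum_range_sub']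
  linarith [h0 (p k), h1 (p 0)]

theorem james_sqrt_le {x : ℕ → ℝ} {V : ℝ} (hx : ∀ j, |x j| ≤ 1)
    (hV : ∀ p : ℕ → ℕ, StrictMono p → ∀ k,
      ∑ i ∈ Finset.range k, |x (p (i + 1)) - x (p i)| ≤ V)
    {p : ℕ → ℕ} (hp : StrictMono p) (k : ℕ) :
    √((x (p 0)) ^ 2 + ∑ i ∈ Finset.range k, (x (p (i + 1)) - x (p i)) ^ 2) ≤ √(1 + 2 * V) := by
  refine Real.sqrt_le_sqrt (add_le_add ((sq_le_one_iff_abs_le_one _).2 (hx _)) ?_)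
  refine le_trans ?_ (mul_le_mul_of_nonneg_left (hV p hp k) zero_le_two)
  rw [Finset.mul_sum]
  refine Finset.sum_le_sum fun i _ => ?_
  rw [← sq_abs, sq]
  refine mul_le_mul_of_nonneg_right ?_ (abs_nonneg _)
  linarith [abs_sub (x (p (i + 1))) (x (p i)), hx (p (i + 1)), hx (p i)]

theorem jamesNorm_le_sqrt {x : ℕ → ℝ} {V : ℝ} (hx : ∀ j, |x j| ≤ 1)
    (hV : ∀ p : ℕ → ℕ, StrictMono p → ∀ k,
      ∑ i ∈ Finset.range k, |x (p (i + 1)) - x (p i)| ≤ V) :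
    jamesNorm x ≤ √(1 + 2 * V) := by
  refine Real.sSup_le ?_ (Real.sqrt_nonneg _)
  rintro _ ⟨k, p, hp, rfl⟩
  exact james_sqrt_le hx hV hp k

theorem abs_le_jamesNorm_s15 {x : ℕ → ℝ} {V : ℝ} (hx : ∀ j, |x j| ≤ 1)
    (hV : ∀ p : ℕ → ℕ, StrictMono p → ∀ k,
      ∑ i ∈ Finset.range k, |x (p (i + 1)) - x (p i)| ≤ V) (j : ℕ) :
    |x j| ≤ jamesNorm x := by
  refine le_csSup ⟨√(1 + 2 * V), ?_⟩ ⟨0, fun i => i + j, fun _ _ h => by simpa using h, ?_⟩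
  · rintro _ ⟨k, p, hp, rfl⟩
    exact james_sqrt_le hx hV hp k
  · simp [Real.sqrt_sq_eq_abs]

theorem jamesNorm_signed_sum_le (N : ℕ) (τ : ℕ → ℝ) (hτ : ∀ k, |τ k| ≤ 1) (a : ℕ → ℕ → ℝ)
    (ha : ∀ k, Antitone (a k)) (hmono : Monotone a) (h0 : ∀ k j, 0 ≤ a k j)
    (h1 : ∀ k j, a k j ≤ 1) :
    jamesNorm (fun j => ∑ k ∈ Finset.range N, τ k * (a (k + 1) j - a k j)) ≤
      √(1 + 2 * (2 * N)) := by
  refine jamesNorm_le_sqrt (fun j => ?_) fun p hp n => ?_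
  · calc |∑ k ∈ Finset.range N, τ k * (a (k + 1) j - a k j)|
        ≤ ∑ k ∈ Finset.range N, (a (k + 1) j - a k j) := by
          refine (Finset.abs_sum_le_sum_abs _ _).trans (Finset.sum_le_sum fun k _ => ?_)
          have h := sub_nonneg.2 (hmono (Nat.le_succ k) j)
          rw [abs_mul, abs_of_nonneg h]
          exact mul_le_of_le_one_left h (hτ k)
      _ ≤ 1 := by
          rw [Finset.sum_range_sub fun k => a k j]
          linarith [h0 0 j, h1 N j]
  · calc ∑ i ∈ Finset.range n, |∑ k ∈ Finset.range N, τ k * (a (k + 1) (p (i + 1)) - a k (p (i + 1)))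
            - ∑ k ∈ Finset.range N, τ k * (a (k + 1) (p i) - a k (p i))|
        ≤ ∑ i ∈ Finset.range n, ∑ k ∈ Finset.range N,
            (|a (k + 1) (p (i + 1)) - a (k + 1) (p i)| + |a k (p (i + 1)) - a k (p i)|) := by
          refine Finset.sum_le_sum fun i _ => ?_
          rw [← Finset.sum_sub_distrib]
          refine (Finset.abs_sum_le_sum_abs _ _).trans (Finset.sum_le_sum fun k _ => ?_)
          rw [← mul_sub, abs_mul, sub_sub_sub_comm]
          exact (mul_le_of_le_one_left (abs_nonneg _) (hτ k)).trans (abs_sub _ _)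
      _ ≤ ∑ k ∈ Finset.range N, (2 : ℝ) := by
          rw [Finset.sum_comm]
          refine Finset.sum_le_sum fun k _ => ?_
          rw [Finset.sum_add_distrib]
          linarith [sum_abs_sub_le_of_antitone (ha (k + 1)) (h0 _) (h1 _) hp n,
            sum_abs_sub_le_of_antitone (ha k) (h0 _) (h1 _) hp n]
      _ = 2 * N := by simp [mul_comm]

theorem antitone_weight {b : ℝ} (hb : 0 ≤ b) :
    Antitone fun n : ℕ => max 0 (1 - 2 ^ n * b) := fun m n h => by
  have : (2 : ℝ) ^ m ≤ 2 ^ n := pow_le_pow_right₀ one_le_two h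
  dsimp only
  gcongr

theorem weight_le_one {b : ℝ} (hb : 0 ≤ b) (n : ℕ) : max 0 (1 - 2 ^ n * b) ≤ 1 :=
  max_le zero_le_one (by have : 0 ≤ 2 ^ n * b := by positivity
                         linarith)

theorem norm_signed_blocks_le {M : ℝ} (hM : 0 < M) {f : ℕ → C(I, ℝ)}
    (hf : ∀ (n : ℕ) (lam : ℕ → ℝ), ‖∑ i ∈ Finset.Icc 1 n, lam i • f i‖ ≤
        M * jamesNorm (fun j => if j < n then lam (j + 1) else 0))
    {s : ℕ → ℕ} (hs : Monotone s) (N : ℕ) {τ : ℕ → ℝ} (hτ : ∀ k, |τ k| ≤ 1) :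
    ‖∑ k ∈ Finset.range N, τ k • (∑ i ∈ Finset.Icc 1 (s (k + 1)), gMap f i
        - ∑ i ∈ Finset.Icc 1 (s k), gMap f i)‖ ≤ M * √(1 + 2 * (2 * N)) := by
  refine (ContinuousMap.norm_le _ (by positivity)).2 fun ⟨a, b⟩ => ?_
  set w : ℕ → ℝ := fun n => max 0 (1 - 2 ^ n * (b : ℝ)) with hw
  have hwa : Antitone w := antitone_weight b.2.1
  have hw0 : ∀ n, 0 ≤ w n := fun n => le_max_left _ _
  have hw1 : ∀ n, w n ≤ 1 := weight_le_one b.2.1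
  set A : ℕ → ℕ → ℝ := fun k j => if j < s k then w (j + 1) else 0 with hA
  set lam : ℕ → ℝ := fun i => ∑ k ∈ Finset.range N, τ k *
    ((if i ≤ s (k + 1) then w i else 0) - (if i ≤ s k then w i else 0)) with hlam
  have hpart : ∀ n ≤ s N, (∑ i ∈ Finset.Icc 1 n, gMap f i) (a, b) =
      ∑ i ∈ Finset.Icc 1 (s N), (if i ≤ n then w i else 0) * f i a := by
    intro n hn
    have : Finset.Icc 1 n = (Finset.Icc 1 (s N)).filter (· ≤ n) := by
      ext i; simp only [Finset.mem_Icc, Finset.mem_filter]; omega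
    simp only [ContinuousMap.coe_sum, Finset.sum_apply, this, Finset.sum_filter]
    refine Finset.sum_congr rfl fun i _ => ?_
    split_ifs <;> simp [gMap, hw, mul_comm]
  have hval : (∑ k ∈ Finset.range N, τ k • (∑ i ∈ Finset.Icc 1 (s (k + 1)), gMap f i
        - ∑ i ∈ Finset.Icc 1 (s k), gMap f i)) (a, b) =
      (∑ i ∈ Finset.Icc 1 (s N), lam i • f i) a := by
    simp only [ContinuousMap.coe_sum, Finset.sum_apply, ContinuousMap.coe_smul, Pi.smul_apply,
      smul_eq_mul, hlam, Finset.sum_mul]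
    rw [Finset.sum_comm]
    refine Finset.sum_congr rfl fun k hk => ?_
    have hk := Finset.mem_range.1 hk
    rw [ContinuousMap.sub_apply, hpart _ (hs hk), hpart _ (hs hk.le), ← Finset.sum_sub_distrib,
      Finset.mul_sum]
    exact Finset.sum_congr rfl fun i _ => by ring
  have hseq : (fun j => if j < s N then lam (j + 1) else 0) =
      fun j => ∑ k ∈ Finset.range N, τ k * (A (k + 1) j - A k j) := by
    funext j
    split_ifs with h
    · rfl
    · refine (Finset.sum_eq_zero fun k hk => ?_).symm
      have hk := Finset.mem_range.1 hk
      have h1 : s (k + 1) ≤ s N := hs hk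
      have h2 : s k ≤ s N := hs hk.le
      simp only [hA]
      rw [if_neg (by omega), if_neg (by omega)]
      simp
  rw [hval]
  refine (ContinuousMap.norm_coe_le_norm _ a).trans ((hf _ _).trans ?_)
  rw [hseq]
  refine mul_le_mul_of_nonneg_left (jamesNorm_signed_sum_le N τ hτ A ?_ ?_ ?_ ?_) hM.le
  · intro k i j hij
    simp only [hA]
    split_ifs
    · exact hwa (by omega)
    · omega
    · exact hw0 _
    · exact le_rfl
  · intro k l hkl j
    have := hs hkl
    simp only [hA]
    split_ifs
    · exact le_rfl
    · omega
    · exact hw0 _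
    · exact le_rfl
  · intro k j
    simp only [hA]
    split_ifs
    exacts [hw0 _, le_rfl]
  · intro k j
    simp only [hA]
    split_ifs
    exacts [hw1 _, zero_le_one]

theorem gMap_partial_sums_weakly_cauchy {M : ℝ} (hM : 0 < M) {f : ℕ → C(I, ℝ)}
    (hf : ∀ (n : ℕ) (lam : ℕ → ℝ), ‖∑ i ∈ Finset.Icc 1 n, lam i • f i‖ ≤
        M * jamesNorm (fun j => if j < n then lam (j + 1) else 0))
    (φ : C(I × I, ℝ) →L[ℝ] ℝ) :
    CauchySeq fun n => φ (∑ i ∈ Finset.Icc 1 n, gMap f i) := by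
  rw [Metric.cauchySeq_iff']
  by_contra! ⟨ε, hε, h⟩
  choose next hnext hdist using h
  set s : ℕ → ℕ := fun k => next^[k] 0 with hs
  have hsucc : ∀ k, s (k + 1) = next (s k) := fun k => Function.iterate_succ_apply' _ _ _
  have hmono : Monotone s := monotone_nat_of_le_succ fun k => by rw [hsucc]; exact hnext _
  set d : ℕ → C(I × I, ℝ) := fun k =>
    ∑ i ∈ Finset.Icc 1 (s (k + 1)), gMap f i - ∑ i ∈ Finset.Icc 1 (s k), gMap f i with hd
  have hdε : ∀ k, ε ≤ |φ (d k)| := fun k => by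
    have := hdist (s k)
    rwa [Real.dist_eq, ← hsucc, ← map_sub] at this
  set τ : ℕ → ℝ := fun k => SignType.sign (φ (d k)) with hτ_def
  have hτ : ∀ k, |τ k| ≤ 1 := fun k => by
    rcases lt_trichotomy (φ (d k)) 0 with h | h | h <;> simp [hτ_def, h]
  have hbound : ∀ N : ℕ, N * ε ≤ ‖φ‖ * (M * √(1 + 2 * (2 * N))) := fun N => by
    calc N * ε = ∑ k ∈ Finset.range N, ε := by simp
      _ ≤ ∑ k ∈ Finset.range N, |φ (d k)| := Finset.sum_le_sum fun k _ => hdε k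
      _ = φ (∑ k ∈ Finset.range N, τ k • d k) := by
        simp [hτ_def, sign_mul_self]
      _ ≤ ‖φ‖ * ‖∑ k ∈ Finset.range N, τ k • d k‖ := (le_abs_self _).trans (φ.le_opNorm _)
      _ ≤ _ := mul_le_mul_of_nonneg_left (norm_signed_blocks_le hM hf hmono N hτ) (by positivity)
  obtain ⟨N, hN⟩ := exists_nat_gt (5 * (‖φ‖ * M) ^ 2 / ε ^ 2)
  rw [div_lt_iff₀ (by positivity)] at hN
  have hN0 : (0 : ℝ) < N := by
    have : 0 < (N : ℝ) * ε ^ 2 := lt_of_le_of_lt (by positivity) hN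
    exact pos_of_mul_pos_left this (by positivity)
  have hN1 : (1 : ℝ) ≤ N := by exact_mod_cast (Nat.cast_pos.1 hN0 : 0 < N)
  have hsq := pow_le_pow_left₀ (by positivity) (hbound N) 2
  rw [← mul_assoc, mul_pow _ (√_), Real.sq_sqrt (by positivity)] at hsq
  have h5 : (‖φ‖ * M) ^ 2 * (1 + 2 * (2 * N)) ≤ (‖φ‖ * M) ^ 2 * (5 * N) :=
    mul_le_mul_of_nonneg_left (by linarith) (by positivity)
  nlinarith [mul_lt_mul_of_pos_left hN hN0]

theorem half_le_norm_weight_diff {M : ℝ} (hM : 0 < M) {f : ℕ → C(I, ℝ)}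
    (hf : ∀ (n : ℕ) (lam : ℕ → ℝ),
      (1 / M) * jamesNorm (fun j => if j < n then lam (j + 1) else 0) ≤
        ‖∑ i ∈ Finset.Icc 1 n, lam i • f i‖) (m : ℕ) :
    1 / M * (1 / 2) ≤ ‖∑ i ∈ Finset.Icc 1 (m + 2), (max 0 (1 - 2 ^ i * (1 / 2 : ℝ) ^ (m + 2)) -
      max 0 (1 - 2 ^ i * (1 / 2 : ℝ) ^ (m + 1))) • f i‖ := by
  refine le_trans (mul_le_mul_of_nonneg_left ?_ (by positivity)) (hf (m + 2) _)
  set u : ℕ → ℕ → ℝ := fun l j => max 0 (1 - 2 ^ (j + 1) * (1 / 2 : ℝ) ^ l) with hu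
  have hzero : ∀ l j, l ≤ j + 1 → u l j = 0 := fun l j h => by
    refine max_eq_left ?_
    have : (1 : ℝ) ≤ 2 ^ (j + 1) * (1 / 2) ^ l := by
      rw [one_div, inv_pow, ← div_eq_mul_inv, one_le_div (by positivity)]
      exact pow_le_pow_right₀ one_le_two h
    linarith
  have hseq : (fun j => if j < m + 2 then max 0 (1 - 2 ^ (j + 1) * (1 / 2 : ℝ) ^ (m + 2)) -
      max 0 (1 - 2 ^ (j + 1) * (1 / 2 : ℝ) ^ (m + 1)) else 0) =
      fun j => u (m + 2) j - u (m + 1) j := by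
    funext j
    split_ifs with h
    · rfl
    · rw [hzero _ _ (by omega), hzero _ _ (by omega), sub_zero]
  have hanti : ∀ l, Antitone (u l) := fun l i j hij =>
    antitone_weight (b := (1 / 2 : ℝ) ^ l) (by positivity) (Nat.succ_le_succ hij)
  have h0 : ∀ l j, 0 ≤ u l j := fun l j => le_max_left _ _
  have h1 : ∀ l j, u l j ≤ 1 := fun l j => weight_le_one (by positivity) _
  rw [hseq]
  refine le_trans ?_ (abs_le_jamesNorm_s15 (V := 2) (fun j => ?_) (fun p hp k => ?_) m)
  · rw [hzero (m + 1) m le_rfl, sub_zero]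
    refine le_trans ?_ (le_abs_self _)
    refine le_trans (le_of_eq ?_) (le_max_right _ _)
    rw [pow_succ (1 / 2 : ℝ), ← mul_assoc, ← mul_pow]
    norm_num
  · exact abs_le.2 ⟨by linarith [h0 (m + 2) j, h1 (m + 1) j],
      by linarith [h0 (m + 1) j, h1 (m + 2) j]⟩
  · calc _ ≤ ∑ i ∈ Finset.range k, (|u (m + 2) (p (i + 1)) - u (m + 2) (p i)| +
            |u (m + 1) (p (i + 1)) - u (m + 1) (p i)|) := Finset.sum_le_sum fun i _ => by
          rw [sub_sub_sub_comm]
          exact abs_sub _ _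
      _ ≤ 2 := by
          rw [Finset.sum_add_distrib]
          linarith [sum_abs_sub_le_of_antitone (hanti (m + 2)) (h0 _) (h1 _) hp k,
            sum_abs_sub_le_of_antitone (hanti (m + 1)) (h0 _) (h1 _) hp k]

theorem gMap_partial_sums_apply_of_le (f : ℕ → C(I, ℝ)) (a b : I) (l : ℕ)
    (hb : (b : ℝ) = (1 / 2) ^ l) {n : ℕ} (hn : l ≤ n) :
    (∑ i ∈ Finset.Icc 1 n, gMap f i) (a, b) =
      ∑ i ∈ Finset.Icc 1 l, max 0 (1 - 2 ^ i * (1 / 2 : ℝ) ^ l) * f i a := by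
  simp only [ContinuousMap.coe_sum, Finset.sum_apply]
  rw [← Finset.sum_subset (Finset.Icc_subset_Icc_right hn)]
  · exact Finset.sum_congr rfl fun i _ => by simp [gMap, hb, mul_comm]
  · intro i hi hi'
    have hli : l ≤ i := by
      simp only [Finset.mem_Icc] at hi hi'
      omega
    have : (1 : ℝ) ≤ 2 ^ i * (1 / 2) ^ l := by
      rw [one_div, inv_pow, ← div_eq_mul_inv, one_le_div (by positivity)]
      exact pow_le_pow_right₀ one_le_two hli
    have h0 : max 0 (1 - 2 ^ i * (b : ℝ)) = 0 := max_eq_left (by rw [hb]; linarith)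
    simp only [gMap, ContinuousMap.coe_mk, h0, mul_zero]

theorem gMap_partial_sums_not_weakly_convergent {M : ℝ} (hM : 0 < M) {f : ℕ → C(I, ℝ)}
    (hf : ∀ (n : ℕ) (lam : ℕ → ℝ),
      (1 / M) * jamesNorm (fun j => if j < n then lam (j + 1) else 0) ≤
        ‖∑ i ∈ Finset.Icc 1 n, lam i • f i‖) (g : C(I × I, ℝ))
    (hg : ∀ φ : C(I × I, ℝ) →L[ℝ] ℝ,
      Filter.Tendsto (fun n => φ (∑ i ∈ Finset.Icc 1 n, gMap f i)) Filter.atTop (nhds (φ g))) :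
    False := by
  set γ : ℕ → I := fun l => ⟨(1 / 2) ^ l, by positivity, pow_le_one₀ (by norm_num) (by norm_num)⟩
    with hγ
  have hval : ∀ a l n, l ≤ n → g (a, γ l) =
      ∑ i ∈ Finset.Icc 1 n, max 0 (1 - 2 ^ i * (1 / 2 : ℝ) ^ l) * f i a := by
    intro a l n hn
    have hlim := hg (ContinuousMap.evalCLM ℝ (a, γ l))
    simp only [ContinuousMap.evalCLM_apply] at hlim
    refine tendsto_nhds_unique hlim (tendsto_const_nhds.congr' ?_)
    filter_upwards [Filter.eventually_ge_atTop n] with k hk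
    rw [gMap_partial_sums_apply_of_le f a _ l rfl (hn.trans hk),
      ← gMap_partial_sums_apply_of_le f a (γ l) l rfl hn]
    simp [gMap, hγ, mul_comm]
  obtain ⟨δ, hδ, hunif⟩ := Metric.uniformContinuous_iff.1
    (CompactSpace.uniformContinuous_of_continuous g.continuous) (1 / M * (1 / 4)) (by positivity)
  obtain ⟨m, hm⟩ := exists_pow_lt_of_lt_one hδ (by norm_num : (1 / 2 : ℝ) < 1)
  have hle := half_le_norm_weight_diff hM hf m
  have hsmall : ‖∑ i ∈ Finset.Icc 1 (m + 2), (max 0 (1 - 2 ^ i * (1 / 2 : ℝ) ^ (m + 2)) -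
      max 0 (1 - 2 ^ i * (1 / 2 : ℝ) ^ (m + 1))) • f i‖ ≤ 1 / M * (1 / 4) := by
    refine (ContinuousMap.norm_le _ (by positivity)).2 fun a => ?_
    have hdist : dist (a, γ (m + 2)) (a, γ (m + 1)) < δ := by
      have hpos : (0 : ℝ) < (1 / 2) ^ m := by positivity
      rw [Prod.dist_eq, dist_self, max_lt_iff, Subtype.dist_eq, Real.dist_eq]
      refine ⟨hδ, lt_of_le_of_lt (abs_le.2 ?_) hm⟩
      simp only [hγ, pow_succ]
      constructor <;> linarith
    have := (hunif hdist).le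
    rw [Real.dist_eq, hval a (m + 2) (m + 2) le_rfl, hval a (m + 1) (m + 2) (by omega),
      ← Finset.sum_sub_distrib] at this
    simpa [ContinuousMap.coe_sum, Finset.sum_apply, sub_mul] using this
  have hMpos : 0 < 1 / M := by positivity
  linarith

/-- Let `M > 0` and `(f_n)` be a sequence of continuous real-valued functions on `[0,1]`
such that `(1/M)·‖(λ_1,…,λ_n,0,…)‖_J ≤ ‖λ_1 f_1 + ⋯ + λ_n f_n‖_∞ ≤ M·‖(λ_1,…,λ_n,0,…)‖_J`
for every `n` and all reals `λ_1, …, λ_n`.  With `g_n(a,b) = f_n(a)·max(0, 1 − 2ⁿ b)` on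
`K = [0,1]²`, the sequence of partial sums `(g_1 + ⋯ + g_n)_n` is weakly Cauchy in `C(K)`
(i.e. `(φ(g_1 + ⋯ + g_n))_n` converges for every continuous linear functional `φ` on
`C(K)`), but it is not weakly convergent in `C(K)`. -/
theorem gMap_partial_sums_weakly_cauchy_not_weakly_convergent (M : ℝ) (hM : 0 < M)
    (f : ℕ → C(I, ℝ))
    (hf : ∀ (n : ℕ) (lam : ℕ → ℝ),
      (1 / M) * jamesNorm (fun j => if j < n then lam (j + 1) else 0) ≤
        ‖∑ i ∈ Finset.Icc 1 n, lam i • f i‖ ∧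
      ‖∑ i ∈ Finset.Icc 1 n, lam i • f i‖ ≤
        M * jamesNorm (fun j => if j < n then lam (j + 1) else 0)) :
    (∀ φ : C(I × I, ℝ) →L[ℝ] ℝ, ∃ L : ℝ,
      Filter.Tendsto (fun n => φ (∑ i ∈ Finset.Icc 1 n, gMap f i))
        Filter.atTop (nhds L)) ∧
    ¬ ∃ g : C(I × I, ℝ), ∀ φ : C(I × I, ℝ) →L[ℝ] ℝ,
      Filter.Tendsto (fun n => φ (∑ i ∈ Finset.Icc 1 n, gMap f i))
        Filter.atTop (nhds (φ g)) := by
  exact ⟨fun φ => cauchySeq_tendsto_of_complete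
      (gMap_partial_sums_weakly_cauchy hM (fun n lam => (hf n lam).2) φ),
    fun ⟨g, hg⟩ => gMap_partial_sums_not_weakly_convergent hM (fun n lam => (hf n lam).1) g hg⟩
end
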